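/- Let T be a finitary pretriangulated category over finite hom-sets. Then for all objects x, y, z, t of T, the derived Hall numbers satisfy the associativity identity ∑_{[w]} g^w_{x,y} · g^t_{w,z} = ∑_{[w]} g^w_{y,z} · g^t_{x,w}, where both sums range over isomorphism classes of objects w of T, each sum has only finitely many nonzero terms, and each summand depends only on the isomorphism class of the chosen representative w. -/

import Mathlib

open CategoryTheory CategoryTheory.Limits CategoryTheory.Pretriangulated

namespace DerivedHall

variable (T : Type*) [Category T] [HasZeroObject T] [HasShift T ℤ]
  [Preadditive T] [∀ n : ℤ, (CategoryTheory.shiftFunctor T n).Additive] [Pretriangulated T]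

/-- The vanishing part of the finitary condition. -/
def Finitary : Prop :=
  ∀ x y : T, ∃ N : ℕ, ∀ i : ℕ, N ≤ i → ∀ f : x ⟶ y⟦(-(i : ℤ))⟧, f = 0

/-- `[x,z]_y`: the set of morphisms `f : x ⟶ z` admitting a distinguished triangle
`x ⟶ z ⟶ y' ⟶ x⟦1⟧` whose third object `y'` is isomorphic to `y`. -/
def hallSet (x z y : T) : Set (x ⟶ z) :=
  {f | ∃ (y' : T) (g : z ⟶ y') (h : y' ⟶ x⟦(1 : ℤ)⟧),
      (Triangle.mk f g h ∈ distTriang T) ∧ Nonempty (y' ≅ y)}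

/-- The alternating product `∏_{i>0} |Ext^{-i}(x,y)|^{(-1)^i}`. -/
noncomputable def extAltProd (x y : T) : ℚ :=
  ∏ᶠ i : ℕ, ((Nat.card (x ⟶ y⟦(-(i : ℤ) - 1)⟧) : ℚ) ^ ((-1 : ℤ) ^ (i + 1)))

/-- The derived Hall number `g^z_{x,y}`. -/
noncomputable def hallNumber (x y z : T) : ℚ :=
  ((Nat.card (hallSet T x z y) : ℚ) * extAltProd T x z) /
    ((Nat.card (Aut x) : ℚ) * extAltProd T x x)

/-- Isomorphism classes of objects of `T`. -/
abbrev IsoClass := Quotient (isIsomorphicSetoid T)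

/-- The isomorphism class of an object. -/
def cls (x : T) : IsoClass T := Quotient.mk (isIsomorphicSetoid T) x

/-- The derived Hall number as a function of isomorphism classes, defined via chosen
representatives. -/
noncomputable def hallNumberQ (a b c : IsoClass T) : ℚ :=
  hallNumber T (Quotient.out a) (Quotient.out b) (Quotient.out c)

theorem card_ker_mul_card_range {A B : Type*} [AddGroup A] [AddGroup B] (f : A →+ B) :
    Nat.card f.ker * Nat.card f.range = Nat.card A := by
  rw [← AddSubgroup.index_ker, AddSubgroup.card_mul_index]

theorem exists_pow_isIdempotentElem {M : Type*} [Monoid M] [Finite M] (m : M) :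
    ∃ k, IsIdempotentElem (m ^ (k + 1)) := by
  obtain ⟨i, j, hij, h⟩ : ∃ i j : ℕ, i < j ∧ m ^ i = m ^ j := by
    obtain ⟨i, j, hne, h⟩ := Finite.exists_ne_map_eq_of_infinite (fun n : ℕ => m ^ n)
    rcases lt_or_gt_of_ne hne with h' | h'
    exacts [⟨i, j, h', h⟩, ⟨j, i, h', h.symm⟩]
  obtain ⟨d, rfl⟩ := Nat.exists_eq_add_of_lt hij
  have step : ∀ c n, i ≤ n → m ^ (n + c * (d + 1)) = m ^ n := by
    intro c
    induction c with
    | zero => simp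
    | succ c ih =>
      intro n hn
      obtain ⟨l, rfl⟩ := Nat.exists_eq_add_of_le hn
      rw [show i + l + (c + 1) * (d + 1) = (i + d + 1) + (l + c * (d + 1)) by ring, pow_add, ← h,
        ← pow_add, ← add_assoc, ih _ hn]
  refine ⟨(i + 1) * (d + 1) - 1, ?_⟩
  rw [Nat.sub_add_cancel (Nat.mul_pos (by omega) (by omega)), IsIdempotentElem, ← pow_add]
  exact step _ _ (by nlinarith)

section Separation

variable {C : Type*} [Category C] [Preadditive C] [HasFiniteBiproducts C]
  [∀ a b : C, Finite (a ⟶ b)] {X Y : C}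

theorem exists_not_isNilpotent
    (hK : ∀ {b c : C} (v : b ⟶ c), Nat.card (Preadditive.leftComp X v).ker =
      Nat.card (Preadditive.leftComp Y v).ker)
    (f : X ⟶ Y) (g : Y ⟶ X) (hf : f ≫ g ≫ f = f) (hg : g ≫ f ≫ g = g)
    (hfg : f ≫ g ≠ 𝟙 X) :
    ∃ (h : X ⟶ Y) (r : Y ⟶ X),
      ¬ IsNilpotent (R := End X) (h ≫ (𝟙 Y - g ≫ f) ≫ r ≫ (𝟙 X - f ≫ g)) := by
  classical
  have := Fintype.ofFinite (X ⟶ Y)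
  by_contra! hnil
  set e : X ⟶ X := 𝟙 X - f ≫ g with he
  set e' : Y ⟶ Y := 𝟙 Y - g ≫ f with he'
  have hee : e ≫ e = e := by simp [he, reassoc_of% hf]
  have hef : e ≫ f = 0 := by simp [he, hf]
  have hge : g ≫ e = 0 := by simp [he, hg]
  let u : X ⟶ ⨁ (fun _ : X ⟶ Y => Y) := biproduct.lift (fun k => k ≫ e')
  have hu : ∀ {Z : C} (s : (⨁ (fun _ : X ⟶ Y => Y)) ⟶ Z),
      u ≫ s = ∑ k : X ⟶ Y, k ≫ e' ≫ biproduct.ι (fun _ : X ⟶ Y => Y) k ≫ s := by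
    intro Z s
    have hu₀ : u = ∑ k : X ⟶ Y, (k ≫ e') ≫ biproduct.ι (fun _ : X ⟶ Y => Y) k :=
      biproduct.hom_ext _ _ fun j => by
        simp [u, Preadditive.sum_comp, biproduct.ι_π, comp_ite]
    rw [hu₀]
    simp only [Preadditive.sum_comp, Category.assoc]
  have hu' : ∀ k : X ⟶ Y, k ≫ e' = u ≫ biproduct.π _ k := by simp [u]
  let NX := (Preadditive.leftComp X u).range
  let NY := (Preadditive.leftComp Y u).range
  have hcard : ∀ {b c : C} (v : b ⟶ c), Nat.card (Preadditive.leftComp X v).range =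
      Nat.card (Preadditive.leftComp Y v).range := by
    intro b c v
    have h1 := card_ker_mul_card_range (Preadditive.leftComp X v)
    have h2 := card_ker_mul_card_range (Preadditive.leftComp Y v)
    have h0 : Nat.card (c ⟶ X) = Nat.card (c ⟶ Y) := by
      have h3 := hK (0 : c ⟶ c)
      have h4 : ∀ Z : C, Preadditive.leftComp Z (0 : c ⟶ c) = 0 := by
        intro Z; ext; simp [Preadditive.leftComp]
      simpa [h4] using h3
    rw [← hK v, ← h0, ← h1] at h2
    exact (Nat.eq_of_mul_eq_mul_left Nat.card_pos h2).symm
  have hXY : Nat.card (X ⟶ X) = Nat.card (X ⟶ Y) := by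
    have h3 := hK (0 : X ⟶ X)
    have h4 : ∀ Z : C, Preadditive.leftComp Z (0 : X ⟶ X) = 0 := by
      intro Z; ext; simp [Preadditive.leftComp]
    simpa [h4] using h3
  let ψ : (X ⟶ X) →+ (X ⟶ Y) ⧸ NY :=
    (QuotientAddGroup.mk' NY).comp (Preadditive.rightComp X f)
  have hψ : Function.Surjective ψ := by
    intro q
    obtain ⟨a, rfl⟩ := QuotientAddGroup.mk'_surjective NY q
    refine ⟨a ≫ g, ?_⟩
    refine (QuotientAddGroup.eq).2 ⟨biproduct.π _ a, ?_⟩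
    change u ≫ _ = - ((a ≫ g) ≫ f) + a
    rw [← hu']
    simp [he']
    abel
  have hker : Nat.card ψ.ker = Nat.card NX := by
    have h1 := card_ker_mul_card_range ψ
    rw [AddMonoidHom.range_eq_top.2 hψ, Nat.card_congr AddSubgroup.topEquiv.toEquiv] at h1
    have h2 := AddSubgroup.card_eq_card_quotient_mul_card_addSubgroup NY
    rw [hXY, h2, ← hcard u, mul_comm] at h1
    exact Nat.eq_of_mul_eq_mul_left Nat.card_pos h1
  have hle : NX ≤ ψ.ker := by
    rintro _ ⟨s, rfl⟩
    rw [AddMonoidHom.mem_ker]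
    exact (QuotientAddGroup.eq_zero_iff _).2 ⟨s ≫ f, by simp [Preadditive.leftComp, Preadditive.rightComp]⟩
  have heN : e ∈ NX := by
    have : NX = ψ.ker := AddSubgroup.eq_of_le_of_card_ge hle hker.le
    rw [this, AddMonoidHom.mem_ker]
    exact (QuotientAddGroup.eq_zero_iff _).2 (by simp [Preadditive.rightComp, hef])
  obtain ⟨s, hs⟩ := heN
  replace hs : u ≫ s = e := hs
  have hunit : ∀ S : Finset (X ⟶ Y), IsIso (𝟙 X -
      ∑ k ∈ S, k ≫ e' ≫ (biproduct.ι (fun _ : X ⟶ Y => Y) k ≫ s) ≫ e) := by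
    intro S
    induction S using Finset.induction_on with
    | empty => simpa using (inferInstance : IsIso (𝟙 X))
    | insert k S hk ih =>
      rw [Finset.sum_insert hk]
      set w := 𝟙 X - ∑ k ∈ S, k ≫ e' ≫ (biproduct.ι (fun _ : X ⟶ Y => Y) k ≫ s) ≫ e
      have h1 := (hnil (inv w ≫ k) (biproduct.ι (fun _ : X ⟶ Y => Y) k ≫ s)).isUnit_one_sub
      rw [isUnit_iff_isIso] at h1
      have h2 : 𝟙 X - (k ≫ e' ≫ (biproduct.ι (fun _ : X ⟶ Y => Y) k ≫ s) ≫ e +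
          ∑ k ∈ S, k ≫ e' ≫ (biproduct.ι (fun _ : X ⟶ Y => Y) k ≫ s) ≫ e) =
          w ≫ (𝟙 X - (inv w ≫ k) ≫ e' ≫ (biproduct.ι (fun _ : X ⟶ Y => Y) k ≫ s) ≫ e) := by
        simp [Preadditive.comp_sub, w]
        abel
      rw [h2]
      have h3 : IsIso (𝟙 X - (inv w ≫ k) ≫ e' ≫
        (biproduct.ι (fun _ : X ⟶ Y => Y) k ≫ s) ≫ e) := h1
      infer_instance
  have h1 := hunit Finset.univ
  have h2 : ∑ k : X ⟶ Y, k ≫ e' ≫ (biproduct.ι (fun _ : X ⟶ Y => Y) k ≫ s) ≫ e = e := by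
    have := congrArg (· ≫ e) (hu s)
    simp only [hs, hee, Preadditive.sum_comp, Category.assoc] at this
    simpa only [Category.assoc] using this.symm
  rw [h2] at h1
  have h3 : 𝟙 X - e = f ≫ g := by simp [he]
  rw [h3] at h1
  apply hfg
  rw [← cancel_epi (f ≫ g)]
  simp [hg]

theorem nonempty_iso_of_card_ker_eq
    (hK : ∀ {b c : C} (v : b ⟶ c), Nat.card (Preadditive.leftComp X v).ker =
      Nat.card (Preadditive.leftComp Y v).ker) : Nonempty (X ≅ Y) := by
  classical
  let S : Set ((X ⟶ Y) × (Y ⟶ X)) := {q | q.1 ≫ q.2 ≫ q.1 = q.1 ∧ q.2 ≫ q.1 ≫ q.2 = q.2}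
  obtain ⟨⟨f, g⟩, ⟨hf, hg⟩, hmax⟩ := S.toFinite.exists_maximalFor
    (fun q => Nat.card (Preadditive.leftComp X (q.1 ≫ q.2)).range) S ⟨(0, 0), by simp [S]⟩
  dsimp only at hf hg hmax
  by_cases hfg : f ≫ g = 𝟙 X
  · have h0 : Nat.card (Y ⟶ X) = Nat.card (Y ⟶ Y) := by
      have h3 := hK (0 : Y ⟶ Y)
      have h4 : ∀ Z : C, Preadditive.leftComp Z (0 : Y ⟶ Y) = 0 := by
        intro Z; ext; simp [Preadditive.leftComp]
      simpa [h4] using h3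
    have hinj : Function.Injective (fun k : Y ⟶ X => k ≫ f) := by
      intro k l hkl
      simpa [hfg] using congrArg (· ≫ g) hkl
    obtain ⟨k, hk⟩ := ((Nat.bijective_iff_injective_and_card _).2 ⟨hinj, h0⟩).2 (𝟙 Y)
    have hk : k ≫ f = 𝟙 Y := hk
    have : g = k := by
      rw [← Category.id_comp g, ← hk, Category.assoc, hfg, Category.comp_id]
    exact ⟨⟨f, g, hfg, this ▸ hk⟩⟩
  · exfalso
    obtain ⟨h, r, hnil⟩ := exists_not_isNilpotent hK f g hf hg hfg
    set e : X ⟶ X := 𝟙 X - f ≫ g with he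
    set e' : Y ⟶ Y := 𝟙 Y - g ≫ f with he'
    have hee : e ≫ e = e := by simp [he, reassoc_of% hf]
    have hee' : e' ≫ e' = e' := by simp [he', reassoc_of% hg]
    have hef : e ≫ f = 0 := by simp [he, hf]
    have hge : g ≫ e = 0 := by simp [he, hg]
    have hfe : f ≫ e' = 0 := by simp [he', hf]
    have heg : e' ≫ g = 0 := by simp [he', hg]
    let m₀ : End X := h ≫ e' ≫ r ≫ e
    let m : End X := e ≫ m₀
    have hem : (show End X from e) * m₀ = m₀ := by simp [End.mul_def, m₀, hee]
    have hmn : ¬ IsNilpotent m := by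
      rintro ⟨n, hn⟩
      refine hnil ⟨n + 1, ?_⟩
      change m₀ ^ (n + 1) = 0
      have h1 : m = m₀ * (show End X from e) := rfl
      rw [h1] at hn
      rw [pow_succ', ← congrArg (· ^ n) hem, ← mul_pow_mul, hn, zero_mul]
    have : Finite (End X) := inferInstanceAs (Finite (X ⟶ X))
    obtain ⟨k, hk⟩ := exists_pow_isIdempotentElem m
    have hπ0 : m ^ (k + 1) ≠ 0 := fun h0 => hmn ⟨_, h0⟩
    obtain ⟨π, hπ⟩ : ∃ π : X ⟶ X, π = m ^ (k + 1) := ⟨_, rfl⟩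
    obtain ⟨ρ, hρ⟩ : ∃ ρ : X ⟶ X, ρ = m ^ k := ⟨_, rfl⟩
    have hππ : π ≫ π = π := by rw [hπ]; exact hk
    have hmρ : e ≫ h ≫ e' ≫ r ≫ e ≫ ρ = π := by
      rw [hπ, hρ, pow_succ, End.mul_def]
      simp [m, m₀]
    have hπe : π ≫ e = π := by
      rw [hπ, pow_succ', End.mul_def]
      simp [m, m₀, hee]
    have heπ : e ≫ π = π := by
      rw [← hmρ, reassoc_of% hee]
    have hgπ : g ≫ π = 0 := by rw [← heπ, reassoc_of% hge, zero_comp]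
    have hπf : π ≫ f = 0 := by rw [← hπe, Category.assoc, hef, comp_zero]
    let h₁ : X ⟶ Y := π ≫ h ≫ e'
    let g₁ : Y ⟶ X := e' ≫ r ≫ e ≫ ρ ≫ π
    have h11 : h₁ ≫ g₁ = π := by
      have : π ≫ h ≫ e' ≫ r ≫ e ≫ ρ ≫ π = π ≫ (e ≫ h ≫ e' ≫ r ≫ e ≫ ρ) ≫ π := by
        simp only [Category.assoc, reassoc_of% hπe]
      simp only [h₁, g₁, Category.assoc, reassoc_of% hee', this, hmρ, hππ]
    have hfg₁ : f ≫ g₁ = 0 := by simp only [g₁, reassoc_of% hfe, zero_comp]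
    have hh₁g : h₁ ≫ g = 0 := by simp only [h₁, Category.assoc, heg, comp_zero]
    have hgh₁ : g ≫ h₁ = 0 := by simp only [h₁, reassoc_of% hgπ, zero_comp]
    have hg₁f : g₁ ≫ f = 0 := by simp only [g₁, Category.assoc, hπf, comp_zero]
    have hsum : (f + h₁) ≫ (g + g₁) = f ≫ g + π := by
      simp [hfg₁, hh₁g, h11]
    have hπh₁ : π ≫ h₁ = h₁ := by simp only [h₁, reassoc_of% hππ]
    have hg₁π : g₁ ≫ π = g₁ := by simp only [g₁, Category.assoc, hππ]
    have hmem : ((f + h₁, g + g₁) : (X ⟶ Y) × (Y ⟶ X)) ∈ S := by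
      refine ⟨?_, ?_⟩
      · dsimp only
        rw [← Category.assoc, hsum]
        simp [hf, hgh₁, hπf, hπh₁]
      · dsimp only
        rw [hsum]
        simp [hg, hgπ, hg₁π, reassoc_of% hg₁f]
    have hpp : (f ≫ g) ≫ (f ≫ g + π) = f ≫ g := by simp [hg, hgπ]
    have hpp' : (f ≫ g + π) ≫ f ≫ g = f ≫ g := by simp [reassoc_of% hf, reassoc_of% hπf]
    have hπp' : (f ≫ g + π) ≫ π = π := by simp [hgπ, hππ]
    have hle : (Preadditive.leftComp X (f ≫ g)).range ≤
        (Preadditive.leftComp X ((f + h₁) ≫ (g + g₁))).range := by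
      rw [hsum]
      rintro _ ⟨s, rfl⟩
      refine ⟨(f ≫ g) ≫ s, ?_⟩
      change (f ≫ g + π) ≫ (f ≫ g) ≫ s = (f ≫ g) ≫ s
      rw [← Category.assoc, hpp']
    have hle' := hmax hmem (AddSubgroup.card_le_of_le hle)
    have heq := AddSubgroup.eq_of_le_of_card_ge hle hle'
    have hmemπ : π ∈ (Preadditive.leftComp X (f ≫ g)).range := by
      rw [heq, hsum]
      exact ⟨π, hπp'⟩
    obtain ⟨s, hs⟩ := hmemπ
    replace hs : (f ≫ g) ≫ s = π := hs
    apply hπ0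
    rw [← hπ, ← hππ]
    nth_rw 2 [← hs]
    simp only [Category.assoc, reassoc_of% hπf, zero_comp]

end Separation
section Triangles

variable {T}
variable {w t z : T} {f : w ⟶ t} {g : t ⟶ z} {h : z ⟶ w⟦(1 : ℤ)⟧}

theorem comp_mor₁₂ (hT : Triangle.mk f g h ∈ distTriang T) :
    f ≫ g = 0 := comp_distTriang_mor_zero₁₂ _ hT

theorem comp_mor₂₃ (hT : Triangle.mk f g h ∈ distTriang T) :
    g ≫ h = 0 := comp_distTriang_mor_zero₂₃ _ hT

theorem comp_mor₃₁ (hT : Triangle.mk f g h ∈ distTriang T) :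
    h ≫ f⟦(1 : ℤ)⟧' = 0 := comp_distTriang_mor_zero₃₁ _ hT

theorem exists_lift₁ (hT : Triangle.mk f g h ∈ distTriang T)
    {b : T} (u : b ⟶ t) (hu : u ≫ g = 0) : ∃ v : b ⟶ w, v ≫ f = u :=
  (Triangle.coyoneda_exact₂ _ hT u hu).imp fun _ h => h.symm

theorem exists_lift₂ (hT : Triangle.mk f g h ∈ distTriang T)
    {b : T} (u : b ⟶ z) (hu : u ≫ h = 0) : ∃ v : b ⟶ t, v ≫ g = u :=
  (Triangle.coyoneda_exact₃ _ hT u hu).imp fun _ h => h.symm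

theorem exists_lift₃ (hT : Triangle.mk f g h ∈ distTriang T)
    {b : T} (u : b ⟶ w⟦(1 : ℤ)⟧) (hu : u ≫ f⟦(1 : ℤ)⟧' = 0) :
    ∃ v : b ⟶ z, v ≫ h = u :=
  (Triangle.coyoneda_exact₁ _ hT u hu).imp fun _ h => h.symm

theorem exists_desc₂ (hT : Triangle.mk f g h ∈ distTriang T)
    {c : T} (u : t ⟶ c) (hu : f ≫ u = 0) : ∃ v : z ⟶ c, g ≫ v = u :=
  (Triangle.yoneda_exact₂ _ hT u hu).imp fun _ h => h.symm

theorem exists_desc₃ (hT : Triangle.mk f g h ∈ distTriang T)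
    {c : T} (u : z ⟶ c) (hu : g ≫ u = 0) : ∃ v : w⟦(1 : ℤ)⟧ ⟶ c, h ≫ v = u :=
  (Triangle.yoneda_exact₃ _ hT u hu).imp fun _ h => h.symm

theorem rotate_mem (hT : Triangle.mk f g h ∈ distTriang T) :
    Triangle.mk g h (-f⟦(1 : ℤ)⟧') ∈ distTriang T := rot_of_distTriang _ hT

theorem rotate_neg_mem (hT : Triangle.mk f g h ∈ distTriang T) :
    Triangle.mk g (-h) (f⟦(1 : ℤ)⟧') ∈ distTriang T := by
  let e : w⟦(1 : ℤ)⟧ ≅ w⟦(1 : ℤ)⟧ := ⟨-𝟙 _, -𝟙 _, by simp, by simp⟩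
  refine isomorphic_distinguished _ (rotate_mem hT) _
    (Triangle.isoMk _ _ (Iso.refl _) (Iso.refl _)
      e ?_ ?_ ?_)
  · exact (Category.comp_id g).trans (Category.id_comp g).symm
  · change (-h) ≫ (-𝟙 _) = 𝟙 z ≫ h
    simp
  · change f⟦(1 : ℤ)⟧' ≫ (𝟙 t)⟦(1 : ℤ)⟧' = (-𝟙 (w⟦(1 : ℤ)⟧)) ≫ (-f⟦(1 : ℤ)⟧')
    simp

theorem exists_desc₁ (hT : Triangle.mk f g h ∈ distTriang T)
    {c : T} (u : w⟦(1 : ℤ)⟧ ⟶ c) (hu : h ≫ u = 0) :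
    ∃ v : t⟦(1 : ℤ)⟧ ⟶ c, f⟦(1 : ℤ)⟧' ≫ v = u :=
  exists_desc₃ (rotate_neg_mem hT) u (by simp [hu])

theorem mk_mem_of_iso (hT : Triangle.mk f g h ∈ distTriang T)
    {z' : T} (e : z' ≅ z) :
    Triangle.mk f (g ≫ e.inv) (e.hom ≫ h) ∈ distTriang T := by
  refine isomorphic_distinguished _ hT _
    (Triangle.isoMk _ _ (Iso.refl _) (Iso.refl _) e ?_ ?_ ?_)
  · exact (Category.comp_id f).trans (Category.id_comp f).symm
  · change (g ≫ e.inv) ≫ e.hom = 𝟙 t ≫ g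
    simp
  · change (e.hom ≫ h) ≫ (𝟙 w)⟦(1 : ℤ)⟧' = e.hom ≫ h
    simp

theorem mk_mem_of_iso₁ (hT : Triangle.mk f g h ∈ distTriang T)
    {w' : T} (e : w' ≅ w) :
    Triangle.mk (e.hom ≫ f) g (h ≫ e.inv⟦(1 : ℤ)⟧') ∈ distTriang T := by
  refine isomorphic_distinguished _ hT _
    (Triangle.isoMk _ _ e (Iso.refl _) (Iso.refl _) ?_ ?_ ?_)
  · exact Category.comp_id _
  · exact (Category.comp_id g).trans (Category.id_comp g).symm
  · change (h ≫ e.inv⟦(1 : ℤ)⟧') ≫ e.hom⟦(1 : ℤ)⟧' = 𝟙 z ≫ h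
    rw [Category.assoc, ← Functor.map_comp, e.inv_hom_id]
    simp

theorem mk_mem_of_iso₂ (hT : Triangle.mk f g h ∈ distTriang T)
    {t' : T} (e : t ≅ t') :
    Triangle.mk (f ≫ e.hom) (e.inv ≫ g) h ∈ distTriang T := by
  refine isomorphic_distinguished _ hT _
    (Triangle.isoMk _ _ (Iso.refl _) e.symm (Iso.refl _) ?_ ?_ ?_)
  · change (f ≫ e.hom) ≫ e.inv = 𝟙 w ≫ f
    simp
  · change (e.inv ≫ g) ≫ 𝟙 z = e.inv ≫ g
    simp
  · change h ≫ (𝟙 w)⟦(1 : ℤ)⟧' = 𝟙 z ≫ h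
    simp

variable {w' t' z' : T} {f' : w' ⟶ t'} {g' : t' ⟶ z'} {h' : z' ⟶ w'⟦(1 : ℤ)⟧}

theorem exists_map₃ (hT : Triangle.mk f g h ∈ distTriang T)
    (hT' : Triangle.mk f' g' h' ∈ distTriang T) (a : w ⟶ w') (b : t ⟶ t')
    (hab : f ≫ b = a ≫ f') : ∃ c : z ⟶ z', g ≫ c = b ≫ g' ∧ h ≫ a⟦(1 : ℤ)⟧' = c ≫ h' :=
  complete_distinguished_triangle_morphism _ _ hT hT' a b hab

theorem exists_map₁ (hT : Triangle.mk f g h ∈ distTriang T)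
    (hT' : Triangle.mk f' g' h' ∈ distTriang T) (b : t ⟶ t') (c : z ⟶ z')
    (hbc : g ≫ c = b ≫ g') : ∃ a : w ⟶ w', f ≫ b = a ≫ f' ∧ h ≫ a⟦(1 : ℤ)⟧' = c ≫ h' :=
  complete_distinguished_triangle_morphism₁ _ _ hT hT' b c hbc

theorem exists_iso₃ (hT : Triangle.mk f g h ∈ distTriang T)
    (hT' : Triangle.mk f' g' h' ∈ distTriang T) (a : w ≅ w') (b : t ≅ t')
    (hab : f ≫ b.hom = a.hom ≫ f') :
    ∃ c : z ≅ z', g ≫ c.hom = b.hom ≫ g' ∧ h ≫ a.hom⟦(1 : ℤ)⟧' = c.hom ≫ h' := by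
  obtain ⟨c, h₁, h₂⟩ := exists_map₃ hT hT' a.hom b.hom hab
  let φ : Triangle.mk f g h ⟶ Triangle.mk f' g' h' :=
    { hom₁ := a.hom, hom₂ := b.hom, hom₃ := c, comm₁ := hab, comm₂ := h₁, comm₃ := h₂ }
  have hc : IsIso φ.hom₃ := isIso₃_of_isIso₁₂ φ hT hT' (inferInstanceAs (IsIso a.hom))
    (inferInstanceAs (IsIso b.hom))
  exact ⟨@asIso _ _ _ _ c hc, h₁, h₂⟩

theorem exists_iso₁ (hT : Triangle.mk f g h ∈ distTriang T)
    (hT' : Triangle.mk f' g' h' ∈ distTriang T) (b : t ≅ t') (c : z ≅ z')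
    (hbc : g ≫ c.hom = b.hom ≫ g') :
    ∃ a : w ≅ w', f ≫ b.hom = a.hom ≫ f' ∧ h ≫ a.hom⟦(1 : ℤ)⟧' = c.hom ≫ h' := by
  obtain ⟨a, h₁, h₂⟩ := exists_map₁ hT hT' b.hom c.hom hbc
  let φ : Triangle.mk f g h ⟶ Triangle.mk f' g' h' :=
    { hom₁ := a, hom₂ := b.hom, hom₃ := c.hom, comm₁ := h₁, comm₂ := hbc, comm₃ := h₂ }
  have ha : IsIso φ.hom₁ := isIso₁_of_isIso₂₃ φ hT hT' (inferInstanceAs (IsIso b.hom))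
    (inferInstanceAs (IsIso c.hom))
  exact ⟨@asIso _ _ _ _ a ha, h₁, h₂⟩

end Triangles

set_option linter.unusedSectionVars false

section ExtAltProd

theorem finprod_alternating_mul (a : ℕ → ℚ) (h0 : ∀ n, a n ≠ 0) (N : ℕ)
    (hN : ∀ n, N ≤ n → a n = 1) :
    (∏ᶠ i : ℕ, a i ^ ((-1 : ℤ) ^ (i + 1))) *
      (a 0 * ∏ᶠ i : ℕ, a (i + 1) ^ ((-1 : ℤ) ^ (i + 1))) = 1 := by
  rw [finprod_eq_prod_of_mulSupport_subset (s := Finset.range (N + 1)),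
    finprod_eq_prod_of_mulSupport_subset (s := Finset.range N), Finset.prod_range_succ']
  · have h : ∀ i, a (i + 1) ^ ((-1 : ℤ) ^ (i + 1 + 1)) * a (i + 1) ^ ((-1 : ℤ) ^ (i + 1)) = 1 := by
      intro i
      rw [← zpow_add₀ (h0 _), pow_succ _ (i + 1)]
      simp
    calc _ = (∏ i ∈ Finset.range N, a (i + 1) ^ ((-1 : ℤ) ^ (i + 1 + 1)) *
            a (i + 1) ^ ((-1 : ℤ) ^ (i + 1))) * ((a 0) ^ (-1 : ℤ) * a 0) := by
          rw [Finset.prod_mul_distrib]; simp; ring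
      _ = 1 := by simp [h, h0]
  · intro i hi
    by_contra hi'
    simp only [Finset.coe_range, Set.mem_Iio, not_lt] at hi'
    exact hi (by simp [hN _ (show N ≤ i + 1 by omega)])
  · intro i hi
    by_contra hi'
    simp only [Finset.coe_range, Set.mem_Iio, not_lt] at hi'
    exact hi (by simp [hN _ (show N ≤ i by omega)])

theorem card_mul_card_of_exact {A B C D : Type*} [AddGroup A] [AddGroup B] [AddGroup C]
    [AddGroup D] (α : A →+ B) (β : B →+ C) (γ : C →+ D) (h₁ : α.range = β.ker)
    (h₂ : β.range = γ.ker) :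
    Nat.card A * Nat.card C = Nat.card B * (Nat.card α.ker * Nat.card γ.range) := by
  rw [← card_ker_mul_card_range α, ← card_ker_mul_card_range β, ← card_ker_mul_card_range γ,
    h₁, h₂]
  ring

variable {T}

theorem card_shift_hom (x y : T) (m n : ℤ) (h : n + 1 = m) :
    Nat.card (x⟦(1 : ℤ)⟧ ⟶ y⟦m⟧) = Nat.card (x ⟶ y⟦n⟧) :=
  Nat.card_congr (((Functor.FullyFaithful.ofFullyFaithful (shiftFunctor T (1 : ℤ))).homEquiv.trans
    ((shiftFunctorAdd' T n 1 m h).symm.app y).homToEquiv).symm)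

theorem card_hom_shift (x y : T) (m n : ℤ) (h : -1 + m = n) :
    Nat.card (x ⟶ (y⟦(-1 : ℤ)⟧)⟦m⟧) = Nat.card (x ⟶ y⟦n⟧) :=
  Nat.card_congr ((shiftFunctorAdd' T (-1) m n h).symm.app y).homToEquiv

theorem extAltProd_congr {x x' y y' : T} (e : x ≅ x') (e' : y ≅ y') :
    extAltProd T x y = extAltProd T x' y' := by
  unfold extAltProd
  refine finprod_congr fun i => ?_
  rw [Nat.card_congr (Iso.homCongr e ((shiftFunctor T (-(i : ℤ) - 1)).mapIso e'))]

variable [∀ x y : T, Finite (x ⟶ y)]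

theorem natCard_hom_ne_zero (x y : T) : (Nat.card (x ⟶ y) : ℚ) ≠ 0 :=
  Nat.cast_ne_zero.2 Nat.card_pos.ne'

theorem Finitary.exists_card_eq_one (hfin : Finitary T) (x y : T) :
    ∃ N : ℕ, ∀ i : ℕ, N ≤ i → Nat.card (x ⟶ y⟦-(i : ℤ)⟧) = 1 := by
  obtain ⟨N, hN⟩ := hfin x y
  refine ⟨N, fun i hi => ?_⟩
  rw [Nat.card_eq_one_iff_unique]
  exact ⟨⟨fun f g => by rw [hN i hi f, hN i hi g]⟩, ⟨0⟩⟩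

theorem card_hom_eq_card_neg_zero (x y : T) :
    Nat.card (x ⟶ y) = Nat.card (x ⟶ y⟦-((0 : ℕ) : ℤ)⟧) :=
  Nat.card_congr ((shiftFunctorZero' T (-((0 : ℕ) : ℤ)) (by simp)).symm.app y).homToEquiv

theorem extAltProd_mul_shift_left (hfin : Finitary T) (x y : T) :
    extAltProd T x y * (Nat.card (x⟦(1 : ℤ)⟧ ⟶ y) * extAltProd T (x⟦(1 : ℤ)⟧) y) = 1 := by
  obtain ⟨N, hN⟩ := hfin.exists_card_eq_one x y
  have h := finprod_alternating_mul (fun i : ℕ => (Nat.card (x ⟶ y⟦-(i : ℤ) - 1⟧) : ℚ))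
    (fun _ => natCard_hom_ne_zero _ _) N (fun i hi => by
      have := hN (i + 1) (by omega)
      rw [Nat.cast_succ, neg_add, ← sub_eq_add_neg] at this
      simp [this])
  unfold extAltProd
  rw [← h]
  congr 2
  · rw [card_hom_eq_card_neg_zero, card_shift_hom _ _ _ (-((0 : ℕ) : ℤ) - 1) (by ring)]
  · refine finprod_congr fun i => ?_
    rw [card_shift_hom _ _ _ (-((i + 1 : ℕ) : ℤ) - 1) (by push_cast; ring)]

theorem extAltProd_mul_shift_right (hfin : Finitary T) (x y : T) :
    extAltProd T x y * (Nat.card (x ⟶ y⟦(-1 : ℤ)⟧) * extAltProd T x (y⟦(-1 : ℤ)⟧)) = 1 := by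
  obtain ⟨N, hN⟩ := hfin.exists_card_eq_one x y
  have h := finprod_alternating_mul (fun i : ℕ => (Nat.card (x ⟶ y⟦-(i : ℤ) - 1⟧) : ℚ))
    (fun _ => natCard_hom_ne_zero _ _) N (fun i hi => by
      have := hN (i + 1) (by omega)
      rw [Nat.cast_succ, neg_add, ← sub_eq_add_neg] at this
      simp [this])
  unfold extAltProd
  rw [← h]
  congr 2
  refine finprod_congr fun i => ?_
  rw [card_hom_shift _ _ _ (-((i + 1 : ℕ) : ℤ) - 1) (by push_cast; ring)]

theorem extAltProd_ne_zero (hfin : Finitary T) (x y : T) : extAltProd T x y ≠ 0 :=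
  left_ne_zero_of_mul_eq_one (extAltProd_mul_shift_left hfin x y)

theorem extAltProd_eq_one {x y : T} (h : ∀ i : ℕ, Nat.card (x ⟶ y⟦-(i : ℤ)⟧) = 1) :
    extAltProd T x y = 1 := by
  unfold extAltProd
  refine finprod_eq_one_of_forall_eq_one fun i => ?_
  have := h (i + 1)
  rw [Nat.cast_succ, neg_add, ← sub_eq_add_neg] at this
  simp [this]

variable {w t z : T} {f : w ⟶ t} {g : t ⟶ z} {h : z ⟶ w⟦(1 : ℤ)⟧}

theorem card_range_mor₃ (hT : Triangle.mk f g h ∈ distTriang T) (b : T) :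
    Nat.card (Preadditive.rightComp (b⟦(1 : ℤ)⟧) h).range =
    Nat.card (Preadditive.rightComp b f).ker := by
  refine (Nat.card_congr (Equiv.subtypeEquiv
    (Functor.FullyFaithful.ofFullyFaithful (shiftFunctor T (1 : ℤ))).homEquiv ?_)).symm
  intro u
  constructor
  · intro hu
    have hu : u ≫ f = 0 := hu
    exact exists_lift₃ hT (u⟦(1 : ℤ)⟧') (by rw [← Functor.map_comp, hu, Functor.map_zero])
  · rintro ⟨v, hv⟩
    have hv : v ≫ h = u⟦(1 : ℤ)⟧' := hv
    have := comp_mor₃₁ hT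
    refine (shiftFunctor T (1 : ℤ)).map_injective ?_
    change (u ≫ f)⟦(1 : ℤ)⟧' = (0 : b ⟶ t)⟦(1 : ℤ)⟧'
    rw [Functor.map_comp, ← hv, Category.assoc, this, comp_zero, Functor.map_zero]

/-- The long exact sequence of a distinguished triangle, in its first three terms of degree
at most `0`, read as an equality of alternating products. -/
theorem extAltProd_mid_left (hfin : Finitary T) (hT : Triangle.mk f g h ∈ distTriang T) (b : T) :
    extAltProd T b t = extAltProd T b w * extAltProd T b z *
      Nat.card (Preadditive.rightComp b f).ker := by
  suffices H : ∀ (N : ℕ) (b : T), (∀ i : ℕ, N ≤ i → Nat.card (b ⟶ w⟦-(i : ℤ)⟧) = 1) →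
      (∀ i : ℕ, N ≤ i → Nat.card (b ⟶ t⟦-(i : ℤ)⟧) = 1) →
      (∀ i : ℕ, N ≤ i → Nat.card (b ⟶ z⟦-(i : ℤ)⟧) = 1) →
      extAltProd T b t = extAltProd T b w * extAltProd T b z *
        Nat.card (Preadditive.rightComp b f).ker by
    obtain ⟨N₁, h₁⟩ := hfin.exists_card_eq_one b w
    obtain ⟨N₂, h₂⟩ := hfin.exists_card_eq_one b t
    obtain ⟨N₃, h₃⟩ := hfin.exists_card_eq_one b z
    exact H (N₁ + N₂ + N₃) b (fun i hi => h₁ i (by omega)) (fun i hi => h₂ i (by omega))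
      (fun i hi => h₃ i (by omega))
  clear b
  intro N
  induction N with
  | zero =>
    intro b h₁ h₂ h₃
    rw [extAltProd_eq_one fun i => h₁ i i.zero_le, extAltProd_eq_one fun i => h₂ i i.zero_le,
      extAltProd_eq_one fun i => h₃ i i.zero_le]
    have h₄ := h₁ 0 le_rfl
    rw [← card_hom_eq_card_neg_zero, Nat.card_eq_one_iff_unique] at h₄
    have := h₄.1
    have hk : Nat.card (Preadditive.rightComp b f).ker = 1 :=
      Nat.card_eq_one_iff_unique.2 ⟨inferInstance, ⟨0⟩⟩
    rw [hk]
    simp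
  | succ N ih =>
    intro b h₁ h₂ h₃
    have hs : ∀ y : T, (∀ i : ℕ, N + 1 ≤ i → Nat.card (b ⟶ y⟦-(i : ℤ)⟧) = 1) →
        ∀ i : ℕ, N ≤ i → Nat.card (b⟦(1 : ℤ)⟧ ⟶ y⟦-(i : ℤ)⟧) = 1 := by
      intro y hy i hi
      rw [card_shift_hom _ _ _ (-((i + 1 : ℕ) : ℤ)) (by push_cast; ring)]
      exact hy _ (by omega)
    have key := ih (b⟦(1 : ℤ)⟧) (hs _ h₁) (hs _ h₂) (hs _ h₃)
    have hex := card_mul_card_of_exact (Preadditive.rightComp (b⟦(1 : ℤ)⟧) f)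
      (Preadditive.rightComp (b⟦(1 : ℤ)⟧) g) (Preadditive.rightComp (b⟦(1 : ℤ)⟧) h)
      (by
        ext u
        constructor
        · rintro ⟨v, rfl⟩
          have := comp_mor₁₂ hT
          simp [Preadditive.rightComp, AddMonoidHom.mem_ker, this]
        · intro hu
          exact exists_lift₁ hT u hu)
      (by
        ext u
        constructor
        · rintro ⟨v, rfl⟩
          have := comp_mor₂₃ hT
          simp [Preadditive.rightComp, AddMonoidHom.mem_ker, this]
        · intro hu
          exact exists_lift₂ hT u hu)
    rw [card_range_mor₃ hT b] at hex
    have e₁ := extAltProd_mul_shift_left hfin b w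
    have e₂ := extAltProd_mul_shift_left hfin b t
    have e₃ := extAltProd_mul_shift_left hfin b z
    have hex' : (Nat.card (b⟦(1 : ℤ)⟧ ⟶ w) : ℚ) * Nat.card (b⟦(1 : ℤ)⟧ ⟶ z) =
      Nat.card (b⟦(1 : ℤ)⟧ ⟶ t) * (Nat.card (Preadditive.rightComp (b⟦(1 : ℤ)⟧) f).ker *
        Nat.card (Preadditive.rightComp b f).ker) := mod_cast hex
    rw [key] at e₂
    have hw := right_ne_zero_of_mul_eq_one e₁
    have hz := right_ne_zero_of_mul_eq_one e₃
    rw [eq_div_of_mul_eq hw e₁, eq_div_of_mul_eq hz e₃,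
      eq_div_of_mul_eq (right_ne_zero_of_mul_eq_one e₂) e₂]
    rw [div_mul_div_comm, div_mul_eq_mul_div, div_eq_div_iff
      (right_ne_zero_of_mul_eq_one e₂) (mul_ne_zero hw hz)]
    linear_combination (extAltProd T (b⟦(1 : ℤ)⟧) w * extAltProd T (b⟦(1 : ℤ)⟧) z) * hex'

theorem extAltProd_mid_right (hfin : Finitary T) (hT : Triangle.mk f g h ∈ distTriang T) (c : T) :
    extAltProd T t c = extAltProd T w c * extAltProd T z c *
      Nat.card (Preadditive.leftComp c g).ker := by
  suffices H : ∀ (N : ℕ) (c : T), (∀ i : ℕ, N ≤ i → Nat.card (w ⟶ c⟦-(i : ℤ)⟧) = 1) →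
      (∀ i : ℕ, N ≤ i → Nat.card (t ⟶ c⟦-(i : ℤ)⟧) = 1) →
      (∀ i : ℕ, N ≤ i → Nat.card (z ⟶ c⟦-(i : ℤ)⟧) = 1) →
      extAltProd T t c = extAltProd T w c * extAltProd T z c *
        Nat.card (Preadditive.leftComp c g).ker by
    obtain ⟨N₁, h₁⟩ := hfin.exists_card_eq_one w c
    obtain ⟨N₂, h₂⟩ := hfin.exists_card_eq_one t c
    obtain ⟨N₃, h₃⟩ := hfin.exists_card_eq_one z c
    exact H (N₁ + N₂ + N₃) c (fun i hi => h₁ i (by omega)) (fun i hi => h₂ i (by omega))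
      (fun i hi => h₃ i (by omega))
  clear c
  intro N
  induction N with
  | zero =>
    intro c h₁ h₂ h₃
    rw [extAltProd_eq_one fun i => h₁ i i.zero_le, extAltProd_eq_one fun i => h₂ i i.zero_le,
      extAltProd_eq_one fun i => h₃ i i.zero_le]
    have h₄ := h₃ 0 le_rfl
    rw [← card_hom_eq_card_neg_zero, Nat.card_eq_one_iff_unique] at h₄
    have := h₄.1
    have hk : Nat.card (Preadditive.leftComp c g).ker = 1 :=
      Nat.card_eq_one_iff_unique.2 ⟨inferInstance, ⟨0⟩⟩
    rw [hk]
    simp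
  | succ N ih =>
    intro c h₁ h₂ h₃
    have hs : ∀ y : T, (∀ i : ℕ, N + 1 ≤ i → Nat.card (y ⟶ c⟦-(i : ℤ)⟧) = 1) →
        ∀ i : ℕ, N ≤ i → Nat.card (y ⟶ (c⟦(-1 : ℤ)⟧)⟦-(i : ℤ)⟧) = 1 := by
      intro y hy i hi
      rw [card_hom_shift _ _ _ (-((i + 1 : ℕ) : ℤ)) (by push_cast; ring)]
      exact hy _ (by omega)
    have key := ih (c⟦(-1 : ℤ)⟧) (hs _ h₁) (hs _ h₂) (hs _ h₃)
    let θ : (c⟦(-1 : ℤ)⟧)⟦(1 : ℤ)⟧ ≅ c := (shiftFunctorCompIsoId T (-1 : ℤ) 1 (by simp)).app c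
    let γ : (w ⟶ c⟦(-1 : ℤ)⟧) →+ (z ⟶ c) :=
      (Preadditive.leftComp c h).comp ((Preadditive.rightComp _ θ.hom).comp
        (shiftFunctor T (1 : ℤ)).mapAddHom)
    have hγ : ∀ u, γ u = h ≫ u⟦(1 : ℤ)⟧' ≫ θ.hom := fun u => rfl
    have hex := card_mul_card_of_exact (Preadditive.leftComp (c⟦(-1 : ℤ)⟧) g)
      (Preadditive.leftComp (c⟦(-1 : ℤ)⟧) f) γ
      (by
        ext u
        constructor
        · rintro ⟨v, rfl⟩
          have := comp_mor₁₂ hT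
          simp [Preadditive.leftComp, AddMonoidHom.mem_ker, reassoc_of% this]
        · intro hu
          exact exists_desc₂ hT u hu)
      (by
        ext u
        constructor
        · rintro ⟨v, rfl⟩
          have := comp_mor₃₁ hT
          rw [AddMonoidHom.mem_ker, hγ]
          simp [Preadditive.leftComp, reassoc_of% this]
        · intro hu
          rw [AddMonoidHom.mem_ker, hγ] at hu
          have hu' : h ≫ u⟦(1 : ℤ)⟧' = 0 := by
            rw [← cancel_mono θ.hom, Category.assoc, hu, zero_comp]
          obtain ⟨v, hv⟩ := exists_desc₁ hT (u⟦(1 : ℤ)⟧') hu'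
          refine ⟨(shiftFunctor T (1 : ℤ)).preimage v, ?_⟩
          refine (shiftFunctor T (1 : ℤ)).map_injective ?_
          rw [← hv]
          simp [Preadditive.leftComp])
    have hr : γ.range = (Preadditive.leftComp c g).ker := by
      ext u
      constructor
      · rintro ⟨v, rfl⟩
        have := comp_mor₂₃ hT
        rw [hγ]
        simp [Preadditive.leftComp, AddMonoidHom.mem_ker, reassoc_of% this]
      · intro hu
        obtain ⟨v, hv⟩ := exists_desc₃ hT u hu
        refine ⟨(shiftFunctor T (1 : ℤ)).preimage (v ≫ θ.inv), ?_⟩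
        rw [hγ, ← hv]
        simp
    rw [hr] at hex
    have e₁ := extAltProd_mul_shift_right hfin w c
    have e₂ := extAltProd_mul_shift_right hfin t c
    have e₃ := extAltProd_mul_shift_right hfin z c
    have hex' : (Nat.card (z ⟶ c⟦(-1 : ℤ)⟧) : ℚ) * Nat.card (w ⟶ c⟦(-1 : ℤ)⟧) =
      Nat.card (t ⟶ c⟦(-1 : ℤ)⟧) * (Nat.card (Preadditive.leftComp (c⟦(-1 : ℤ)⟧) g).ker *
        Nat.card (Preadditive.leftComp c g).ker) := mod_cast hex
    rw [key] at e₂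
    have hw := right_ne_zero_of_mul_eq_one e₁
    have hz := right_ne_zero_of_mul_eq_one e₃
    rw [eq_div_of_mul_eq hw e₁, eq_div_of_mul_eq hz e₃,
      eq_div_of_mul_eq (right_ne_zero_of_mul_eq_one e₂) e₂]
    rw [div_mul_div_comm, div_mul_eq_mul_div, div_eq_div_iff
      (right_ne_zero_of_mul_eq_one e₂) (mul_ne_zero hw hz)]
    linear_combination (extAltProd T w (c⟦(-1 : ℤ)⟧) * extAltProd T z (c⟦(-1 : ℤ)⟧)) * hex'

end ExtAltProd
section IsoCriterion

theorem card_map_ker_mul_card_ker {V X Z : Type*} [AddCommGroup V] [AddCommGroup X]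
    [AddCommGroup Z] [Finite V] (d : V →+ X) (n : V →+ Z) :
    Nat.card (n.ker.map d) * Nat.card d.ker = Nat.card (d.ker.map n) * Nat.card n.ker := by
  have h₁ := card_ker_mul_card_range (d.comp n.ker.subtype)
  have h₂ := card_ker_mul_card_range (n.comp d.ker.subtype)
  rw [AddMonoidHom.range_comp, AddSubgroup.range_subtype] at h₁ h₂
  have h₃ : Nat.card (d.comp n.ker.subtype).ker = Nat.card (n.comp d.ker.subtype).ker :=
    Nat.card_congr
      { toFun := fun v => ⟨⟨v.1.1, v.2⟩, v.1.2⟩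
        invFun := fun v => ⟨⟨v.1.1, v.2⟩, v.1.2⟩
        left_inv := fun _ => rfl
        right_inv := fun _ => rfl }
  rw [h₃] at h₁
  rw [← h₁, ← h₂]
  ring

variable {T} [∀ x y : T, Finite (x ⟶ y)]

/-- The alternating products of the dual Hom-complexes determine an object. -/
theorem nonempty_iso_of_extAltProd_eq (hfin : Finitary T) {X Y : T}
    (h : ∀ b, extAltProd T b X = extAltProd T b Y) : Nonempty (X ≅ Y) := by
  refine nonempty_iso_of_card_ker_eq fun {b c} v => ?_
  obtain ⟨a, f, k, hT⟩ := distinguished_cocone_triangle₁ v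
  have hX := extAltProd_mid_right hfin hT X
  have hY := extAltProd_mid_right hfin hT Y
  rw [h, h, h, hY] at hX
  have := mul_left_cancel₀ (mul_ne_zero (extAltProd_ne_zero hfin _ _)
    (extAltProd_ne_zero hfin _ _)) hX
  exact_mod_cast this.symm

theorem range_rightComp_mor₂ {w t z : T} {f : w ⟶ t} {g : t ⟶ z} {h : z ⟶ w⟦(1 : ℤ)⟧}
    (hT : Triangle.mk f g h ∈ distTriang T) (b : T) :
    (Preadditive.rightComp b g).range = (Preadditive.rightComp b h).ker := by
  ext u
  constructor
  · rintro ⟨v, rfl⟩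
    simp [Preadditive.rightComp, AddMonoidHom.mem_ker, comp_mor₂₃ hT]
  · exact exists_lift₂ hT u

theorem card_ker_rightComp_mor₁ {w t z : T} {f : w ⟶ t} {g : t ⟶ z} {h : z ⟶ w⟦(1 : ℤ)⟧}
    (hT : Triangle.mk f g h ∈ distTriang T) (b : T) :
    Nat.card (Preadditive.rightComp b f).ker *
      Nat.card (Preadditive.rightComp (b⟦(1 : ℤ)⟧) g).range = Nat.card (b⟦(1 : ℤ)⟧ ⟶ z) := by
  rw [← card_range_mor₃ hT b, range_rightComp_mor₂ hT, mul_comm, card_ker_mul_card_range]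

/-- A numerical substitute for the octahedral axiom: if `f` lifts `l` through the fiber `F` of `p`
and `n` extends `p` to the cone `C` of `l`, compatibly with the connecting morphisms, then the
cone of `f` is isomorphic to the fiber of `n`. -/
theorem nonempty_iso_cone_fiber (hfin : Finitary T) {x t z F C y y' : T}
    {i : F ⟶ t} {p : t ⟶ z} {ε : z ⟶ F⟦(1 : ℤ)⟧} (hF : Triangle.mk i p ε ∈ distTriang T)
    {l : x ⟶ t} {j : t ⟶ C} {d : C ⟶ x⟦(1 : ℤ)⟧} (hC : Triangle.mk l j d ∈ distTriang T)
    {f : x ⟶ F} {g : F ⟶ y} {h : y ⟶ x⟦(1 : ℤ)⟧} (hf : Triangle.mk f g h ∈ distTriang T)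
    {k : y' ⟶ C} {n : C ⟶ z} {e : z ⟶ y'⟦(1 : ℤ)⟧} (hn : Triangle.mk k n e ∈ distTriang T)
    (hfi : f ≫ i = l) (hjn : j ≫ n = p) (hε : n ≫ ε = d ≫ f⟦(1 : ℤ)⟧') :
    Nonempty (y ≅ y') := by
  refine nonempty_iso_of_extAltProd_eq hfin fun b => ?_
  have h₁ := extAltProd_mid_left hfin hF b
  have h₂ := extAltProd_mid_left hfin hf b
  have h₃ := extAltProd_mid_left hfin hC b
  have h₄ := extAltProd_mid_left hfin hn b
  let ν := Preadditive.rightComp (b⟦(1 : ℤ)⟧) n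
  let δ := Preadditive.rightComp (b⟦(1 : ℤ)⟧) d
  have cf : Nat.card (Preadditive.rightComp b f).ker = Nat.card (ν.ker.map δ) := by
    refine Nat.card_congr (Equiv.subtypeEquiv
      (Functor.FullyFaithful.ofFullyFaithful (shiftFunctor T (1 : ℤ))).homEquiv ?_)
    intro s
    constructor
    · intro hs
      have hs : s ≫ f = 0 := hs
      obtain ⟨v, hv⟩ := exists_lift₃ hC (s⟦(1 : ℤ)⟧') (by
        rw [← Functor.map_comp, ← hfi, reassoc_of% hs, zero_comp, Functor.map_zero])
      obtain ⟨r, hr⟩ := exists_lift₂ hF (v ≫ n) (by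
        rw [Category.assoc, hε, reassoc_of% hv, ← Functor.map_comp, hs, Functor.map_zero])
      refine ⟨v - r ≫ j, ?_, ?_⟩
      · change (v - r ≫ j) ≫ n = 0
        rw [Preadditive.sub_comp, Category.assoc, hjn, hr, sub_self]
      · change (v - r ≫ j) ≫ d = s⟦(1 : ℤ)⟧'
        rw [Preadditive.sub_comp, Category.assoc, comp_mor₂₃ hC, comp_zero, sub_zero, hv]
    · rintro ⟨v, hv, hvs⟩
      have hv : v ≫ n = 0 := hv
      have hvs : v ≫ d = s⟦(1 : ℤ)⟧' := hvs
      refine (shiftFunctor T (1 : ℤ)).map_injective ?_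
      change (s ≫ f)⟦(1 : ℤ)⟧' = (0 : b ⟶ F)⟦(1 : ℤ)⟧'
      rw [Functor.map_comp, ← hvs, Category.assoc, ← hε, reassoc_of% hv, zero_comp,
        Functor.map_zero]
  have ci := card_ker_rightComp_mor₁ hF b
  have ck := card_ker_rightComp_mor₁ hn b
  have cl := card_range_mor₃ hC b
  have hp : (Preadditive.rightComp (b⟦(1 : ℤ)⟧) p).range = δ.ker.map ν := by
    rw [← range_rightComp_mor₂ hC, ← AddMonoidHom.range_comp]
    congr 1
    ext u
    change u ≫ p = (u ≫ j) ≫ n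
    rw [Category.assoc, hjn]
  rw [hp] at ci
  have e₁ := card_map_ker_mul_card_ker δ ν
  have e₂ := card_ker_mul_card_range δ
  have e₃ := card_ker_mul_card_range ν
  change Nat.card δ.range = _ at cl
  change _ * Nat.card ν.range = _ at ck
  have key : Nat.card (Preadditive.rightComp b f).ker * Nat.card (Preadditive.rightComp b i).ker =
      Nat.card (Preadditive.rightComp b k).ker * Nat.card (Preadditive.rightComp b l).ker := by
    have p₁ : 0 < Nat.card δ.ker := Nat.card_pos
    have p₂ : 0 < Nat.card (δ.ker.map ν) := by
      have : Finite (δ.ker.map ν) := inferInstanceAs (Finite (ν '' δ.ker : Set _))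
      exact Nat.card_pos
    refine Nat.eq_of_mul_eq_mul_right (Nat.mul_pos p₁ p₂) ?_
    rw [cf, ← cl]
    zify at *
    linear_combination (Nat.card (Preadditive.rightComp b i).ker : ℤ) *
      (Nat.card (δ.ker.map ν)) * e₁ + (Nat.card (δ.ker.map ν) : ℤ) * Nat.card ν.ker * (ci - ck)
      + (Nat.card (δ.ker.map ν) : ℤ) * (Nat.card (Preadditive.rightComp b k).ker) * (e₃ - e₂)
  have key' : (Nat.card (Preadditive.rightComp b f).ker : ℚ) *
      Nat.card (Preadditive.rightComp b i).ker =
      Nat.card (Preadditive.rightComp b k).ker * Nat.card (Preadditive.rightComp b l).ker := by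
    exact_mod_cast key
  rw [h₁, h₂, h₄] at h₃
  have nx := extAltProd_ne_zero hfin b x
  have nz := extAltProd_ne_zero hfin b z
  have nk : (Nat.card (Preadditive.rightComp b k).ker : ℚ) ≠ 0 :=
    Nat.cast_ne_zero.2 Nat.card_pos.ne'
  have nl : (Nat.card (Preadditive.rightComp b l).ker : ℚ) ≠ 0 :=
    Nat.cast_ne_zero.2 Nat.card_pos.ne'
  refine mul_right_cancel₀ (mul_ne_zero (mul_ne_zero nx nz) (mul_ne_zero nk nl)) ?_
  linear_combination h₃ - extAltProd T b x * extAltProd T b y * extAltProd T b z * key'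

end IsoCriterion

section Riedtmann

theorem card_mul_card_ker_eq {A B : Type*} [AddGroup A] [AddGroup B] (φ : A →+ B) (b : B)
    (S : Set B) (hS : ∀ s ∈ S, ∃ a, b + φ a = s) :
    Nat.card S * Nat.card φ.ker = Nat.card {a | b + φ a ∈ S} := by
  choose r hr using fun s : S => hS s.1 s.2
  rw [← Nat.card_prod]
  refine Nat.card_congr
    { toFun := fun q => ⟨r q.1 + q.2, ?_⟩
      invFun := fun a => (⟨b + φ a, a.2⟩, ⟨-r ⟨b + φ a, a.2⟩ + a, ?_⟩)
      left_inv := ?_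
      right_inv := ?_ }
  · have := q.2.2
    rw [AddMonoidHom.mem_ker] at this
    simp [this, hr]
  · rw [AddMonoidHom.mem_ker, map_add, map_neg, neg_add_eq_zero]
    exact add_left_cancel (hr ⟨b + φ a, a.2⟩)
  · rintro ⟨s, k⟩
    have hk : φ (k : A) = 0 := k.2
    have hs : (⟨b + φ (r s + k), by simp [hk, hr]⟩ : S) = s := by
      ext
      simp [hk, hr]
    ext
    · simp [hk, hr]
    · simp only [hs]
      simp
  · intro a
    simp

theorem isIso_id_add_comp {C : Type*} [Category C] [Preadditive C] {X Y : C} (f : X ⟶ Y)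
    (g : Y ⟶ X) (h : IsIso (𝟙 X + f ≫ g)) : IsIso (𝟙 Y + g ≫ f) := by
  have h₁ := IsIso.hom_inv_id (𝟙 X + f ≫ g)
  have h₂ := IsIso.inv_hom_id (𝟙 X + f ≫ g)
  generalize inv (𝟙 X + f ≫ g) = e at h₁ h₂
  rw [Preadditive.add_comp, Category.id_comp, Category.assoc] at h₁
  rw [Preadditive.comp_add, Category.comp_id] at h₂
  have h₁ := congrArg (fun k => g ≫ k ≫ f) h₁
  have h₂ := congrArg (fun k => g ≫ k ≫ f) h₂
  simp only [Preadditive.add_comp, Preadditive.comp_add, Category.assoc, Category.id_comp]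
    at h₁ h₂
  refine ⟨𝟙 Y - g ≫ e ≫ f, ?_, ?_⟩
  · have : (𝟙 Y + g ≫ f) ≫ (𝟙 Y - g ≫ e ≫ f) =
        𝟙 Y + (g ≫ f - (g ≫ e ≫ f + g ≫ f ≫ g ≫ e ≫ f)) := by
      simp only [Preadditive.add_comp, Preadditive.comp_sub, Category.comp_id, Category.id_comp,
        Category.assoc]
      abel
    rw [this, h₁, sub_self, add_zero]
  · have : (𝟙 Y - g ≫ e ≫ f) ≫ (𝟙 Y + g ≫ f) =
        𝟙 Y + (g ≫ f - (g ≫ e ≫ f + g ≫ e ≫ f ≫ g ≫ f)) := by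
      simp only [Preadditive.sub_comp, Preadditive.comp_add, Category.comp_id, Category.id_comp,
        Category.assoc]
      abel
    rw [this, h₂, sub_self, add_zero]

/-- The morphisms `g : t ⟶ y` admitting a distinguished triangle `x' ⟶ t ⟶ y ⟶ x'⟦1⟧` with `x'`
isomorphic to `x`. -/
def coHallSet (x t y : T) : Set (t ⟶ y) :=
  {g | ∃ (x' : T) (f : x' ⟶ t) (h : y ⟶ x'⟦(1 : ℤ)⟧),
      (Triangle.mk f g h ∈ distTriang T) ∧ Nonempty (x' ≅ x)}

variable {T}

theorem mem_hallSet_iff {x t y : T} {f : x ⟶ t} :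
    f ∈ hallSet T x t y ↔
      ∃ (g : t ⟶ y) (h : y ⟶ x⟦(1 : ℤ)⟧), Triangle.mk f g h ∈ distTriang T := by
  constructor
  · rintro ⟨y', g, h, hT, ⟨e⟩⟩
    exact ⟨_, _, mk_mem_of_iso hT e.symm⟩
  · rintro ⟨g, h, hT⟩
    exact ⟨y, g, h, hT, ⟨Iso.refl _⟩⟩

theorem mem_coHallSet_iff {x t y : T} {g : t ⟶ y} :
    g ∈ coHallSet T x t y ↔
      ∃ (f : x ⟶ t) (h : y ⟶ x⟦(1 : ℤ)⟧), Triangle.mk f g h ∈ distTriang T := by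
  constructor
  · rintro ⟨y', g, h, hT, ⟨e⟩⟩
    exact ⟨_, _, mk_mem_of_iso₁ hT e.symm⟩
  · rintro ⟨f, h, hT⟩
    exact ⟨x, f, h, hT, ⟨Iso.refl _⟩⟩

theorem mem_hallSet_iff_nonempty_iso {x t y y' : T} {f : x ⟶ t} {g : t ⟶ y'}
    {h : y' ⟶ x⟦(1 : ℤ)⟧} (hT : Triangle.mk f g h ∈ distTriang T) :
    f ∈ hallSet T x t y ↔ Nonempty (y' ≅ y) := by
  constructor
  · rintro ⟨y₁, g₁, h₁, hT₁, ⟨e⟩⟩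
    obtain ⟨c, -⟩ := exists_iso₃ hT hT₁ (Iso.refl _) (Iso.refl _) (by simp)
    exact ⟨c ≪≫ e⟩
  · rintro ⟨e⟩
    exact ⟨y', g, h, hT, ⟨e⟩⟩

theorem mem_coHallSet_iff_nonempty_iso {x x' t y : T} {f : x' ⟶ t} {g : t ⟶ y}
    {h : y ⟶ x'⟦(1 : ℤ)⟧} (hT : Triangle.mk f g h ∈ distTriang T) :
    g ∈ coHallSet T x t y ↔ Nonempty (x' ≅ x) := by
  constructor
  · rintro ⟨x₁, f₁, h₁, hT₁, ⟨e⟩⟩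
    obtain ⟨c, -⟩ := exists_iso₁ hT hT₁ (Iso.refl _) (Iso.refl _) (by simp)
    exact ⟨c ≪≫ e⟩
  · rintro ⟨e⟩
    exact ⟨x', f, h, hT, ⟨e⟩⟩

theorem extAltProd_shift_shift (x y : T) :
    extAltProd T (x⟦(1 : ℤ)⟧) (y⟦(1 : ℤ)⟧) = extAltProd T x y := by
  unfold extAltProd
  refine finprod_congr fun i => ?_
  rw [Nat.card_congr ((shiftComm y (1 : ℤ) (-(i : ℤ) - 1)).homToEquiv),
    ← Nat.card_congr (Functor.FullyFaithful.ofFullyFaithful (shiftFunctor T (1 : ℤ))).homEquiv]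

variable [∀ x y : T, Finite (x ⟶ y)]

instance finite_iso (x : T) : Finite (x ≅ x) :=
  Finite.of_injective (fun e : x ≅ x => e.hom) fun _ _ h => Iso.ext h

theorem card_stabilizer_mul {x t y : T} {f : x ⟶ t} {g : t ⟶ y} {h : y ⟶ x⟦(1 : ℤ)⟧}
    (hT : Triangle.mk f g h ∈ distTriang T) :
    Nat.card {β : y ≅ y // g ≫ β.hom = g} * Nat.card (Preadditive.leftComp y h).ker =
      Nat.card {α : x ≅ x // α.hom ≫ f = f} *
        Nat.card (Preadditive.rightComp (x⟦(1 : ℤ)⟧) h).ker := by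
  let σ : (x⟦(1 : ℤ)⟧ ⟶ x⟦(1 : ℤ)⟧) ≃+ (x ⟶ x) :=
    (AddEquiv.ofBijective (shiftFunctor T (1 : ℤ)).mapAddHom
      ⟨(shiftFunctor T (1 : ℤ)).map_injective, (shiftFunctor T (1 : ℤ)).map_surjective⟩).symm
  have hσ : ∀ u, (σ u)⟦(1 : ℤ)⟧' = u := fun u => σ.symm_apply_apply u
  let φ : (x⟦(1 : ℤ)⟧ ⟶ y) →+ (x ⟶ x) :=
    σ.toAddMonoidHom.comp (Preadditive.rightComp (x⟦(1 : ℤ)⟧) h)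
  have hφ : ∀ u, (φ u)⟦(1 : ℤ)⟧' = u ≫ h := fun u => hσ _
  have kφ : φ.ker = (Preadditive.rightComp (x⟦(1 : ℤ)⟧) h).ker := by
    ext u
    exact σ.map_eq_zero_iff
  have hy := card_mul_card_ker_eq (Preadditive.leftComp y h) (𝟙 y)
    {s | IsIso s ∧ g ≫ s = g} (by
      rintro s ⟨-, hs⟩
      obtain ⟨v, hv⟩ := exists_desc₃ hT (s - 𝟙 y) (by simp [hs])
      refine ⟨v, ?_⟩
      change 𝟙 y + h ≫ v = s
      rw [hv]
      abel)
  have hx := card_mul_card_ker_eq φ (𝟙 x) {s | IsIso s ∧ s ≫ f = f} (by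
      rintro s ⟨-, hs⟩
      obtain ⟨v, hv⟩ := exists_lift₃ hT ((s - 𝟙 x)⟦(1 : ℤ)⟧') (by
        rw [← Functor.map_comp]
        simp [hs])
      refine ⟨v, ?_⟩
      refine (shiftFunctor T (1 : ℤ)).map_injective ?_
      rw [Functor.map_add, hφ, hv, Functor.map_sub]
      abel)
  have cy : Nat.card {β : y ≅ y // g ≫ β.hom = g} =
      Nat.card {s : y ⟶ y | IsIso s ∧ g ≫ s = g} :=
    Nat.card_congr
      { toFun := fun β => ⟨β.1.hom, inferInstance, β.2⟩
        invFun := fun s => ⟨@asIso _ _ _ _ s.1 s.2.1, s.2.2⟩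
        left_inv := fun β => Subtype.ext (Iso.ext rfl)
        right_inv := fun s => rfl }
  have cx : Nat.card {α : x ≅ x // α.hom ≫ f = f} =
      Nat.card {s : x ⟶ x | IsIso s ∧ s ≫ f = f} :=
    Nat.card_congr
      { toFun := fun β => ⟨β.1.hom, inferInstance, β.2⟩
        invFun := fun s => ⟨@asIso _ _ _ _ s.1 s.2.1, s.2.2⟩
        left_inv := fun β => Subtype.ext (Iso.ext rfl)
        right_inv := fun s => rfl }
  rw [cy, cx, hy, ← kφ, hx]
  congr 2
  ext γ
  change (IsIso (𝟙 y + h ≫ γ) ∧ g ≫ (𝟙 y + h ≫ γ) = g) ↔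
    (IsIso (𝟙 x + φ γ) ∧ (𝟙 x + φ γ) ≫ f = f)
  have e₁ : g ≫ (𝟙 y + h ≫ γ) = g := by
    rw [Preadditive.comp_add, Category.comp_id, ← Category.assoc, comp_mor₂₃ hT, zero_comp,
      add_zero]
  have e₂ : (𝟙 x + φ γ) ≫ f = f := by
    refine (shiftFunctor T (1 : ℤ)).map_injective ?_
    rw [Functor.map_comp, Functor.map_add, hφ, Preadditive.add_comp, Category.assoc,
      comp_mor₃₁ hT]
    simp
  have e₃ : IsIso (𝟙 x + φ γ) ↔ IsIso (𝟙 (x⟦(1 : ℤ)⟧) + γ ≫ h) := by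
    rw [← hφ, ← (shiftFunctor T (1 : ℤ)).map_id, ← Functor.map_add]
    exact ⟨fun _ => inferInstance, fun _ => isIso_of_fully_faithful (shiftFunctor T (1 : ℤ)) _⟩
  rw [e₃]
  exact ⟨fun hi => ⟨isIso_id_add_comp _ _ hi.1, e₂⟩, fun hi => ⟨isIso_id_add_comp _ _ hi.1, e₁⟩⟩

theorem card_stabilizer_mul_extAltProd (hfin : Finitary T) {x t y : T} {f : x ⟶ t} {g : t ⟶ y}
    {h : y ⟶ x⟦(1 : ℤ)⟧} (hT : Triangle.mk f g h ∈ distTriang T) :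
    (Nat.card {β : y ≅ y // g ≫ β.hom = g} : ℚ) * (extAltProd T y y * extAltProd T x t) =
      Nat.card {α : x ≅ x // α.hom ≫ f = f} * (extAltProd T x x * extAltProd T t y) := by
  have h₁ := extAltProd_mid_right hfin (rotate_mem hT) y
  have h₂ := extAltProd_mid_left hfin (rotate_mem (rotate_mem hT)) (x⟦(1 : ℤ)⟧)
  rw [extAltProd_shift_shift, extAltProd_shift_shift] at h₂
  have h₃ : (Nat.card {β : y ≅ y // g ≫ β.hom = g} : ℚ) *
      Nat.card (Preadditive.leftComp y h).ker =
      Nat.card {α : x ≅ x // α.hom ≫ f = f} *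
        Nat.card (Preadditive.rightComp (x⟦(1 : ℤ)⟧) h).ker := by
    exact_mod_cast card_stabilizer_mul hT
  rw [h₁, h₂]
  linear_combination extAltProd T t y * extAltProd T (x⟦(1 : ℤ)⟧) y * extAltProd T x t * h₃

/-- The pairs of composable morphisms which are part of a distinguished triangle. -/
def trianglePairs (x t y : T) : Set ((x ⟶ t) × (t ⟶ y)) :=
  {q | ∃ h : y ⟶ x⟦(1 : ℤ)⟧, Triangle.mk q.1 q.2 h ∈ distTriang T}

theorem card_hallSet_mul_card_iso (x t y : T) :
    Nat.card (hallSet T x t y) * Nat.card (y ≅ y) =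
      Nat.card (Σ q : trianglePairs x t y, {β : y ≅ y // q.1.2 ≫ β.hom = q.1.2}) := by
  have hg : ∀ f : hallSet T x t y, ∃ g : t ⟶ y, (f.1, g) ∈ trianglePairs x t y := fun f =>
    mem_hallSet_iff.1 f.2
  choose g hg using hg
  have hmem : ∀ q : trianglePairs x t y, q.1.1 ∈ hallSet T x t y := fun q =>
    mem_hallSet_iff.2 ⟨_, q.2⟩
  have hσ : ∀ q : trianglePairs x t y, ∃ σ : y ≅ y, g ⟨_, hmem q⟩ ≫ σ.hom = q.1.2 := by
    intro q
    obtain ⟨h, hT⟩ := hg ⟨_, hmem q⟩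
    obtain ⟨h', hT'⟩ := q.2
    obtain ⟨c, hc, -⟩ := exists_iso₃ hT hT' (Iso.refl _) (Iso.refl _) (by simp)
    exact ⟨c, by simpa using hc⟩
  choose σ hσ using hσ
  rw [← Nat.card_prod]
  symm
  refine Nat.card_eq_of_bijective (fun q => (⟨_, hmem q.1⟩, σ q.1 ≪≫ q.2.1)) ⟨?_, ?_⟩
  · rintro ⟨q, β, hβ⟩ ⟨q', β', hβ'⟩ h
    obtain ⟨h₁, h₂⟩ := Prod.ext_iff.1 h
    dsimp only at h₁ h₂
    have h₃ : g ⟨_, hmem q⟩ ≫ (σ q ≪≫ β).hom = q.1.2 := by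
      rw [Iso.trans_hom, ← Category.assoc, hσ, hβ]
    have h₃' : g ⟨_, hmem q'⟩ ≫ (σ q' ≪≫ β').hom = q'.1.2 := by
      rw [Iso.trans_hom, ← Category.assoc, hσ, hβ']
    obtain rfl : q = q' := by
      refine Subtype.ext (Prod.ext (congrArg Subtype.val h₁) ?_)
      rw [← h₃, ← h₃', h₂, h₁]
    have h₄ : β = β' := by
      refine Iso.ext ((cancel_epi (σ q).hom).1 ?_)
      exact congrArg Iso.hom h₂
    subst h₄
    rfl
  · rintro ⟨f, τ⟩
    have hq : (f.1, g f ≫ τ.hom) ∈ trianglePairs x t y := by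
      obtain ⟨h, hT⟩ := hg f
      exact ⟨_, mk_mem_of_iso hT τ.symm⟩
    refine ⟨⟨⟨_, hq⟩, (σ ⟨_, hq⟩).symm ≪≫ τ, ?_⟩, ?_⟩
    · have := hσ ⟨_, hq⟩
      dsimp only at this
      rw [Iso.trans_hom, Iso.symm_hom, ← Category.assoc]
      congr 1
      rw [Iso.comp_inv_eq, this]
    · refine Prod.ext rfl (Iso.ext ?_)
      simp

theorem card_coHallSet_mul_card_iso (x t y : T) :
    Nat.card (coHallSet T x t y) * Nat.card (x ≅ x) =
      Nat.card (Σ q : trianglePairs x t y, {α : x ≅ x // α.hom ≫ q.1.1 = q.1.1}) := by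
  have hf : ∀ g : coHallSet T x t y, ∃ f : x ⟶ t, (f, g.1) ∈ trianglePairs x t y := fun g =>
    mem_coHallSet_iff.1 g.2
  choose f hf using hf
  have hmem : ∀ q : trianglePairs x t y, q.1.2 ∈ coHallSet T x t y := fun q =>
    mem_coHallSet_iff.2 ⟨_, q.2⟩
  have hσ : ∀ q : trianglePairs x t y, ∃ σ : x ≅ x, σ.hom ≫ f ⟨_, hmem q⟩ = q.1.1 := by
    intro q
    obtain ⟨h, hT⟩ := hf ⟨_, hmem q⟩
    obtain ⟨h', hT'⟩ := q.2
    obtain ⟨c, hc, -⟩ := exists_iso₁ hT' hT (Iso.refl _) (Iso.refl _) (by simp)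
    exact ⟨c, by simpa using hc.symm⟩
  choose σ hσ using hσ
  rw [← Nat.card_prod]
  symm
  refine Nat.card_eq_of_bijective (fun q => (⟨_, hmem q.1⟩, q.2.1 ≪≫ σ q.1)) ⟨?_, ?_⟩
  · rintro ⟨q, β, hβ⟩ ⟨q', β', hβ'⟩ h
    obtain ⟨h₁, h₂⟩ := Prod.ext_iff.1 h
    dsimp only at h₁ h₂
    have h₃ : (β ≪≫ σ q).hom ≫ f ⟨_, hmem q⟩ = q.1.1 := by
      rw [Iso.trans_hom, Category.assoc, hσ, hβ]
    have h₃' : (β' ≪≫ σ q').hom ≫ f ⟨_, hmem q'⟩ = q'.1.1 := by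
      rw [Iso.trans_hom, Category.assoc, hσ, hβ']
    obtain rfl : q = q' := by
      refine Subtype.ext (Prod.ext ?_ (congrArg Subtype.val h₁))
      rw [← h₃, ← h₃', h₂, h₁]
    have h₄ : β = β' := by
      refine Iso.ext ((cancel_mono (σ q).hom).1 ?_)
      exact congrArg Iso.hom h₂
    subst h₄
    rfl
  · rintro ⟨g, τ⟩
    have hq : (τ.hom ≫ f g, g.1) ∈ trianglePairs x t y := by
      obtain ⟨h, hT⟩ := hf g
      exact ⟨_, mk_mem_of_iso₁ hT τ⟩
    refine ⟨⟨⟨_, hq⟩, τ ≪≫ (σ ⟨_, hq⟩).symm, ?_⟩, ?_⟩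
    · have := hσ ⟨_, hq⟩
      dsimp only at this
      rw [Iso.trans_hom, Iso.symm_hom, Category.assoc]
      congr 1
      rw [Iso.inv_comp_eq, this]
    · refine Prod.ext rfl (Iso.ext ?_)
      simp

theorem card_hallSet_mul_eq (hfin : Finitary T) (x t y : T) :
    (Nat.card (hallSet T x t y) : ℚ) * Nat.card (y ≅ y) *
        (extAltProd T y y * extAltProd T x t) =
      Nat.card (coHallSet T x t y) * Nat.card (x ≅ x) *
        (extAltProd T x x * extAltProd T t y) := by
  classical
  have := Fintype.ofFinite (trianglePairs x t y)
  rw [← Nat.cast_mul, ← Nat.cast_mul, card_hallSet_mul_card_iso, card_coHallSet_mul_card_iso,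
    Nat.card_sigma, Nat.card_sigma, Nat.cast_sum, Nat.cast_sum, Finset.sum_mul, Finset.sum_mul]
  refine Finset.sum_congr rfl fun q _ => ?_
  obtain ⟨h, hT⟩ := q.2
  exact card_stabilizer_mul_extAltProd hfin hT

/-- The derived Hall number in terms of the second morphisms of distinguished triangles. -/
theorem hallNumber_eq_coHall (hfin : Finitary T) (x y t : T) :
    hallNumber T x y t = ((Nat.card (coHallSet T x t y) : ℚ) * extAltProd T t y) /
      ((Nat.card (y ≅ y) : ℚ) * extAltProd T y y) := by
  have hA : ∀ x : T, (Nat.card (x ≅ x) : ℚ) ≠ 0 := fun x => Nat.cast_ne_zero.2 Nat.card_pos.ne'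
  have hE := extAltProd_ne_zero hfin
  change _ / ((Nat.card (x ≅ x) : ℚ) * _) = _
  rw [div_eq_div_iff (mul_ne_zero (hA _) (hE _ _)) (mul_ne_zero (hA _) (hE _ _))]
  linear_combination card_hallSet_mul_eq hfin x t y

theorem card_hallSet_congr {x x' t t' y y' : T} (e₁ : x ≅ x') (e₂ : t ≅ t') (e₃ : y ≅ y') :
    Nat.card (hallSet T x t y) = Nat.card (hallSet T x' t' y') := by
  refine Nat.card_congr (Equiv.subtypeEquiv (Iso.homCongr e₁ e₂) fun f => ?_)
  change f ∈ hallSet T x t y ↔ e₁.inv ≫ f ≫ e₂.hom ∈ hallSet T x' t' y'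
  constructor
  · rintro ⟨y₁, g, h, hT, ⟨e⟩⟩
    exact ⟨_, _, _, mk_mem_of_iso₁ (mk_mem_of_iso₂ hT e₂) e₁.symm, ⟨e ≪≫ e₃⟩⟩
  · rintro ⟨y₁, g, h, hT, ⟨e⟩⟩
    have hT' := mk_mem_of_iso₁ (mk_mem_of_iso₂ hT e₂.symm) e₁
    have hf : e₁.hom ≫ (e₁.inv ≫ f ≫ e₂.hom) ≫ e₂.symm.hom = f := by simp
    rw [hf] at hT'
    exact ⟨_, _, _, hT', ⟨e ≪≫ e₃.symm⟩⟩

theorem hallNumber_congr {x x' y y' t t' : T} (e₁ : x ≅ x') (e₂ : y ≅ y') (e₃ : t ≅ t') :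
    hallNumber T x y t = hallNumber T x' y' t' := by
  unfold hallNumber
  rw [card_hallSet_congr e₁ e₃ e₂, extAltProd_congr e₁ e₃, extAltProd_congr e₁ e₁,
    Nat.card_congr (Aut.autMulEquivOfIso e₁).toEquiv]

theorem nonempty_out_cls_iso (x : T) : Nonempty (Quotient.out (cls T x) ≅ x) :=
  Quotient.mk_out (s := isIsomorphicSetoid T) x

theorem hallNumberQ_cls (x y t : T) :
    hallNumberQ T (cls T x) (cls T y) (cls T t) = hallNumber T x y t :=
  hallNumber_congr (nonempty_out_cls_iso x).some (nonempty_out_cls_iso y).some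
    (nonempty_out_cls_iso t).some

end Riedtmann

section Associativity

theorem finsum_mul_card_fiber {I P : Type*} [Finite P] (π : P → I) (φ : I → ℚ) (ν : I → ℕ)
    (hν : ∀ c, ν c = Nat.card {p | π p = c}) :
    (Function.support fun c => φ c * ν c).Finite ∧
      ∑ᶠ c, φ c * ν c = ∑ᶠ p, φ (π p) := by
  classical
  have := Fintype.ofFinite P
  have hs : (Function.support fun c => φ c * ν c) ⊆ Finset.univ.image π := by
    intro c hc
    by_contra hc'
    refine hc ?_
    have : IsEmpty {p | π p = c} := ⟨fun p => hc' (by simpa using ⟨p.1, p.2⟩)⟩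
    simp [hν]
  refine ⟨(Finset.finite_toSet _).subset hs, ?_⟩
  rw [finsum_eq_sum_of_support_subset _ hs, finsum_eq_sum_of_fintype, Finset.sum_comp]
  refine Finset.sum_congr rfl fun c _ => ?_
  rw [hν, nsmul_eq_mul, mul_comm, Nat.card_eq_fintype_card, Fintype.card_subtype]
  simp

theorem card_eq_finsum_fiber {A B : Type*} [Finite A] [Finite B] (S : Set A) (π : A → B) :
    (Nat.card S : ℚ) = ∑ᶠ b, (Nat.card {a | π a = b ∧ a ∈ S} : ℚ) := by
  classical
  have := Fintype.ofFinite B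
  rw [finsum_eq_sum_of_fintype, ← Nat.cast_sum, ← Nat.card_sigma]
  congr 1
  exact Nat.card_congr
    { toFun := fun a => ⟨π a, a, rfl, a.2⟩
      invFun := fun a => ⟨a.2.1, a.2.2.2⟩
      left_inv := fun _ => rfl
      right_inv := by
        rintro ⟨b, a, rfl, ha⟩
        rfl }

variable {T} [∀ x y : T, Finite (x ⟶ y)]

/-- The lifts of `l` through the fiber of `p` with cone `y` and the extensions of `p` to the cone
of `l` with fiber `y` are equinumerous, up to the number of trivial lifts and extensions. -/
theorem card_lifts_mul_eq_card_extensions_mul (hfin : Finitary T) (y : T) {x t z F C : T}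
    {i : F ⟶ t} {p : t ⟶ z} {ε : z ⟶ F⟦(1 : ℤ)⟧} (hF : Triangle.mk i p ε ∈ distTriang T)
    {l : x ⟶ t} {j : t ⟶ C} {d : C ⟶ x⟦(1 : ℤ)⟧} (hC : Triangle.mk l j d ∈ distTriang T) :
    Nat.card {f : x ⟶ F | f ≫ i = l ∧ f ∈ hallSet T x F y} *
        Nat.card (Preadditive.leftComp z j).ker =
      Nat.card {n : C ⟶ z | j ≫ n = p ∧ n ∈ coHallSet T y C z} *
        Nat.card (Preadditive.rightComp x i).ker := by
  by_cases hlp : l ≫ p = 0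
  swap
  · have h₁ : IsEmpty {f : x ⟶ F | f ≫ i = l ∧ f ∈ hallSet T x F y} :=
      ⟨fun f => hlp (by rw [← f.2.1, Category.assoc, comp_mor₁₂ hF, comp_zero])⟩
    have h₂ : IsEmpty {n : C ⟶ z | j ≫ n = p ∧ n ∈ coHallSet T y C z} :=
      ⟨fun n => hlp (by rw [← n.2.1, ← Category.assoc, comp_mor₁₂ hC, zero_comp])⟩
    simp
  obtain ⟨f₀, hf₀⟩ := exists_lift₁ hF l hlp
  obtain ⟨n₀, hn₀, hfn₀⟩ := exists_map₃ hC hF f₀ (𝟙 t) (by rw [Category.comp_id, hf₀])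
  rw [Category.id_comp] at hn₀
  let σ : (x⟦(1 : ℤ)⟧ ⟶ F⟦(1 : ℤ)⟧) ≃+ (x ⟶ F) :=
    (AddEquiv.ofBijective (shiftFunctor T (1 : ℤ)).mapAddHom
      ⟨(shiftFunctor T (1 : ℤ)).map_injective, (shiftFunctor T (1 : ℤ)).map_surjective⟩).symm
  have hσ : ∀ u, (σ u)⟦(1 : ℤ)⟧' = u := fun u => σ.symm_apply_apply u
  let α : (x⟦(1 : ℤ)⟧ ⟶ z) →+ (x ⟶ F) :=
    σ.toAddMonoidHom.comp (Preadditive.rightComp (x⟦(1 : ℤ)⟧) ε)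
  have hα : ∀ u, (α u)⟦(1 : ℤ)⟧' = u ≫ ε := fun u => hσ _
  have hαi : ∀ u, α u ≫ i = 0 := by
    intro u
    refine (shiftFunctor T (1 : ℤ)).map_injective ?_
    rw [Functor.map_comp, hα, Category.assoc, comp_mor₃₁ hF, comp_zero, Functor.map_zero]
  have hα' : ∀ s : x ⟶ F, s ≫ i = 0 → ∃ u, α u = s := by
    intro s hs
    obtain ⟨u, hu⟩ := exists_lift₃ hF (s⟦(1 : ℤ)⟧') (by
      rw [← Functor.map_comp, hs, Functor.map_zero])
    exact ⟨u, (shiftFunctor T (1 : ℤ)).map_injective (by rw [hα, hu])⟩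
  have rα : α.range = (Preadditive.rightComp x i).ker := by
    ext s
    constructor
    · rintro ⟨u, rfl⟩
      exact hαi u
    · exact hα' s
  let β : (x⟦(1 : ℤ)⟧ ⟶ z) →+ (C ⟶ z) := Preadditive.leftComp z d
  have hβ : ∀ u, β u = d ≫ u := fun _ => rfl
  have hβj : ∀ u, j ≫ β u = 0 := by
    intro u
    rw [hβ, ← Category.assoc, comp_mor₂₃ hC, zero_comp]
  have rβ : β.range = (Preadditive.leftComp z j).ker := by
    ext s
    constructor
    · rintro ⟨u, rfl⟩
      exact hβj u
    · exact exists_desc₃ hC s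
  have hL := card_mul_card_ker_eq α f₀ {f : x ⟶ F | f ≫ i = l ∧ f ∈ hallSet T x F y} (by
    rintro s ⟨hs, -⟩
    obtain ⟨u, hu⟩ := hα' (s - f₀) (by rw [Preadditive.sub_comp, hs, hf₀, sub_self])
    exact ⟨u, by rw [hu]; abel⟩)
  have hR := card_mul_card_ker_eq β n₀ {n : C ⟶ z | j ≫ n = p ∧ n ∈ coHallSet T y C z} (by
    rintro s ⟨hs, -⟩
    obtain ⟨u, hu⟩ := exists_desc₃ hC (s - n₀) (by rw [Preadditive.comp_sub, hs, hn₀, sub_self])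
    exact ⟨u, by rw [hβ, hu]; abel⟩)
  have hLR : {u | f₀ + α u ∈ {f : x ⟶ F | f ≫ i = l ∧ f ∈ hallSet T x F y}} =
      {u | n₀ + β u ∈ {n : C ⟶ z | j ≫ n = p ∧ n ∈ coHallSet T y C z}} := by
    ext u
    have e₁ : (f₀ + α u) ≫ i = l := by rw [Preadditive.add_comp, hαi, add_zero, hf₀]
    have e₂ : j ≫ (n₀ + β u) = p := by rw [Preadditive.comp_add, hβj, add_zero, hn₀]
    have e₃ : (n₀ + β u) ≫ ε = d ≫ (f₀ + α u)⟦(1 : ℤ)⟧' := by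
      rw [Functor.map_add, hα, Preadditive.add_comp, Preadditive.comp_add, hfn₀, hβ,
        Category.assoc]
    obtain ⟨y₁, g₁, h₁, hT₁⟩ := distinguished_cocone_triangle (f₀ + α u)
    obtain ⟨y₂, g₂, h₂, hT₂⟩ := distinguished_cocone_triangle₁ (n₀ + β u)
    obtain ⟨e⟩ := nonempty_iso_cone_fiber hfin hF hC hT₁ hT₂ e₁ e₂ e₃
    change (_ ∧ f₀ + α u ∈ hallSet T x F y) ↔ (_ ∧ n₀ + β u ∈ coHallSet T y C z)
    rw [mem_hallSet_iff_nonempty_iso hT₁, mem_coHallSet_iff_nonempty_iso hT₂]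
    exact ⟨fun h => ⟨e₂, h.2.map fun k => e.symm ≪≫ k⟩, fun h => ⟨e₁, h.2.map fun k => e ≪≫ k⟩⟩
  rw [hLR, ← hR] at hL
  have hα₂ := card_ker_mul_card_range α
  have hβ₂ := card_ker_mul_card_range β
  rw [rα] at hα₂
  rw [rβ, ← hα₂] at hβ₂
  refine Nat.eq_of_mul_eq_mul_right (show 0 < Nat.card α.ker from Nat.card_pos) ?_
  rw [mul_right_comm, hL, mul_assoc, hβ₂]
  ring

theorem cls_eq_iff {x : T} {c : IsoClass T} : cls T x = c ↔ Nonempty (x ≅ Quotient.out c) := by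
  conv_lhs => rw [← Quotient.out_eq c]
  exact Quotient.eq (r := isIsomorphicSetoid T)

theorem card_coHallSet_congr {x x' t t' y y' : T} (e₁ : x ≅ x') (e₂ : t ≅ t') (e₃ : y ≅ y') :
    Nat.card (coHallSet T x t y) = Nat.card (coHallSet T x' t' y') := by
  refine Nat.card_congr (Equiv.subtypeEquiv (Iso.homCongr e₂ e₃) fun g => ?_)
  change g ∈ coHallSet T x t y ↔ e₂.inv ≫ g ≫ e₃.hom ∈ coHallSet T x' t' y'
  constructor
  · rintro ⟨x₁, f, h, hT, ⟨e⟩⟩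
    have hT' := mk_mem_of_iso (mk_mem_of_iso₂ hT e₂) e₃.symm
    have hg : (e₂.inv ≫ g) ≫ e₃.symm.inv = e₂.inv ≫ g ≫ e₃.hom := by simp
    rw [hg] at hT'
    exact ⟨_, _, _, hT', ⟨e ≪≫ e₁⟩⟩
  · rintro ⟨x₁, f, h, hT, ⟨e⟩⟩
    have hT' := mk_mem_of_iso (mk_mem_of_iso₂ hT e₂.symm) e₃
    have hg : (e₂.symm.inv ≫ e₂.inv ≫ g ≫ e₃.hom) ≫ e₃.inv = g := by simp
    rw [hg] at hT'
    exact ⟨_, _, _, hT', ⟨e ≪≫ e₁.symm⟩⟩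

/-- The weighted count of lifts equals the weighted count of extensions. -/
theorem finsum_hallSet_eq_finsum_coHallSet (hfin : Finitary T) (x y z t : T)
    (F : (t ⟶ z) → T) (i : ∀ p, F p ⟶ t) (ε : ∀ p, z ⟶ (F p)⟦(1 : ℤ)⟧)
    (hF : ∀ p, Triangle.mk (i p) p (ε p) ∈ distTriang T)
    (C : (x ⟶ t) → T) (j : ∀ l, t ⟶ C l) (d : ∀ l, C l ⟶ x⟦(1 : ℤ)⟧)
    (hC : ∀ l, Triangle.mk l (j l) (d l) ∈ distTriang T) :
    extAltProd T t z * ∑ᶠ p, (Nat.card (hallSet T x (F p) y) : ℚ) * extAltProd T x (F p) =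
      extAltProd T x t * ∑ᶠ l, (Nat.card (coHallSet T y (C l) z) : ℚ) * extAltProd T (C l) z := by
  classical
  have := Fintype.ofFinite (t ⟶ z)
  have := Fintype.ofFinite (x ⟶ t)
  have hl : ∀ p, (Nat.card (hallSet T x (F p) y) : ℚ) = ∑ l : x ⟶ t,
      (Nat.card {f : x ⟶ F p | f ≫ i p = l ∧ f ∈ hallSet T x (F p) y} : ℚ) := by
    intro p
    rw [← finsum_eq_sum_of_fintype]
    exact card_eq_finsum_fiber _ fun f => f ≫ i p
  have hr : ∀ l, (Nat.card (coHallSet T y (C l) z) : ℚ) = ∑ p : t ⟶ z,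
      (Nat.card {n : C l ⟶ z | j l ≫ n = p ∧ n ∈ coHallSet T y (C l) z} : ℚ) := by
    intro l
    rw [← finsum_eq_sum_of_fintype]
    exact card_eq_finsum_fiber _ fun n => j l ≫ n
  rw [finsum_eq_sum_of_fintype, finsum_eq_sum_of_fintype, Finset.mul_sum, Finset.mul_sum]
  simp only [hl, hr, Finset.mul_sum, Finset.sum_mul]
  rw [Finset.sum_comm]
  refine Finset.sum_congr rfl fun l _ => Finset.sum_congr rfl fun p _ => ?_
  have key : (Nat.card {f : x ⟶ F p | f ≫ i p = l ∧ f ∈ hallSet T x (F p) y} : ℚ) *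
        Nat.card (Preadditive.leftComp z (j l)).ker =
      Nat.card {n : C l ⟶ z | j l ≫ n = p ∧ n ∈ coHallSet T y (C l) z} *
        Nat.card (Preadditive.rightComp x (i p)).ker := by
    exact_mod_cast card_lifts_mul_eq_card_extensions_mul hfin y (hF p) (hC l)
  rw [extAltProd_mid_left hfin (hF p) x, extAltProd_mid_right hfin (hC l) z]
  linear_combination extAltProd T x z * extAltProd T (C l) z * extAltProd T x (F p) * key

theorem hallNumber_mul_sums (hfin : Finitary T) (x y z t : T) :
    (Function.support fun c : IsoClass T =>
        hallNumberQ T (cls T x) (cls T y) c * hallNumberQ T c (cls T z) (cls T t)).Finite ∧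
    (Function.support fun c : IsoClass T =>
        hallNumberQ T (cls T y) (cls T z) c * hallNumberQ T (cls T x) c (cls T t)).Finite ∧
    ∑ᶠ c : IsoClass T,
        hallNumberQ T (cls T x) (cls T y) c * hallNumberQ T c (cls T z) (cls T t)
      = ∑ᶠ c : IsoClass T,
          hallNumberQ T (cls T y) (cls T z) c * hallNumberQ T (cls T x) c (cls T t) := by
  have hF := fun p : t ⟶ z => distinguished_cocone_triangle₁ p
  choose F i ε hF using hF
  have hC := fun l : x ⟶ t => distinguished_cocone_triangle l
  choose C j d hC using hC
  have hQ : ∀ (a b : T) (c : IsoClass T),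
      hallNumberQ T (cls T a) (cls T b) c = hallNumber T a b (Quotient.out c) := fun a b c => by
    conv_lhs => rw [← Quotient.out_eq c]
    exact hallNumberQ_cls _ _ _
  have hQ₁ : ∀ (a b : T) (c : IsoClass T),
      hallNumberQ T c (cls T a) (cls T b) = hallNumber T (Quotient.out c) a b := fun a b c => by
    conv_lhs => rw [← Quotient.out_eq c]
    exact hallNumberQ_cls _ _ _
  have hQ₂ : ∀ (a b : T) (c : IsoClass T),
      hallNumberQ T (cls T a) c (cls T b) = hallNumber T a (Quotient.out c) b := fun a b c => by
    conv_lhs => rw [← Quotient.out_eq c]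
    exact hallNumberQ_cls _ _ _
  let v : T → ℚ := fun a => ((Nat.card (a ≅ a) : ℚ) * extAltProd T a a)⁻¹
  have h₁ := finsum_mul_card_fiber (fun p => cls T (F p))
    (fun c => v x * v z * extAltProd T t z * ((Nat.card (hallSet T x (Quotient.out c) y) : ℚ) *
      extAltProd T x (Quotient.out c)))
    (fun c => Nat.card (coHallSet T (Quotient.out c) t z)) (fun c => by
      congr 2
      ext p
      exact (mem_coHallSet_iff_nonempty_iso (hF p)).trans cls_eq_iff.symm)
  have h₂ := finsum_mul_card_fiber (fun l => cls T (C l))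
    (fun c => v x * v z * extAltProd T x t * ((Nat.card (coHallSet T y (Quotient.out c) z) : ℚ) *
      extAltProd T (Quotient.out c) z))
    (fun c => Nat.card (hallSet T x t (Quotient.out c))) (fun c => by
      congr 2
      ext l
      exact (mem_hallSet_iff_nonempty_iso (hC l)).trans cls_eq_iff.symm)
  have e₁ : (fun c : IsoClass T =>
      hallNumberQ T (cls T x) (cls T y) c * hallNumberQ T c (cls T z) (cls T t)) = fun c =>
      v x * v z * extAltProd T t z * ((Nat.card (hallSet T x (Quotient.out c) y) : ℚ) *
        extAltProd T x (Quotient.out c)) * Nat.card (coHallSet T (Quotient.out c) t z) := by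
    ext c
    rw [hQ, hQ₁, hallNumber_eq_coHall hfin (Quotient.out c) z t, hallNumber, div_eq_mul_inv,
      div_eq_mul_inv]
    change _ * v x * (_ * v z) = _
    ring
  have e₂ : (fun c : IsoClass T =>
      hallNumberQ T (cls T y) (cls T z) c * hallNumberQ T (cls T x) c (cls T t)) = fun c =>
      v x * v z * extAltProd T x t * ((Nat.card (coHallSet T y (Quotient.out c) z) : ℚ) *
        extAltProd T (Quotient.out c) z) * Nat.card (hallSet T x t (Quotient.out c)) := by
    ext c
    rw [hQ, hQ₂, hallNumber_eq_coHall hfin y z, hallNumber, div_eq_mul_inv, div_eq_mul_inv]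
    change _ * v z * (_ * v x) = _
    ring
  rw [e₁, e₂]
  refine ⟨h₁.1, h₂.1, ?_⟩
  rw [h₁.2, h₂.2]
  have e₃ : ∀ p, (Nat.card (hallSet T x (Quotient.out (cls T (F p))) y) : ℚ) *
      extAltProd T x (Quotient.out (cls T (F p))) =
      (Nat.card (hallSet T x (F p) y) : ℚ) * extAltProd T x (F p) := by
    intro p
    obtain ⟨e⟩ := nonempty_out_cls_iso (F p)
    rw [card_hallSet_congr (Iso.refl x) e (Iso.refl y), extAltProd_congr (Iso.refl x) e]
  have e₄ : ∀ l, (Nat.card (coHallSet T y (Quotient.out (cls T (C l))) z) : ℚ) *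
      extAltProd T (Quotient.out (cls T (C l))) z =
      (Nat.card (coHallSet T y (C l) z) : ℚ) * extAltProd T (C l) z := by
    intro l
    obtain ⟨e⟩ := nonempty_out_cls_iso (C l)
    rw [card_coHallSet_congr (Iso.refl y) e (Iso.refl z), extAltProd_congr e (Iso.refl z)]
  simp only [e₃, e₄]
  rw [← mul_finsum, ← mul_finsum, mul_assoc, mul_assoc (v x * v z),
    finsum_hallSet_eq_finsum_coHallSet hfin x y z t F i ε hF C j d hC]

end Associativity

/-- Associativity of the derived Hall numbers:
`∑_{[w]} g^w_{x,y} g^t_{w,z} = ∑_{[w]} g^w_{y,z} g^t_{x,w}`, where both sums range over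
isomorphism classes of objects, each summand depends only on the isomorphism class of the
chosen representative `w`, and each sum has only finitely many nonzero terms. -/
theorem hallNumber_assoc [∀ x y : T, Finite (x ⟶ y)] (hfin : Finitary T) (x y z t : T) :
    (∀ w : T, hallNumberQ T (cls T x) (cls T y) (cls T w)
          * hallNumberQ T (cls T w) (cls T z) (cls T t)
        = hallNumber T x y w * hallNumber T w z t) ∧
    (Function.support fun c : IsoClass T =>
        hallNumberQ T (cls T x) (cls T y) c * hallNumberQ T c (cls T z) (cls T t)).Finite ∧
    (Function.support fun c : IsoClass T =>
        hallNumberQ T (cls T y) (cls T z) c * hallNumberQ T (cls T x) c (cls T t)).Finite ∧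
    ∑ᶠ c : IsoClass T,
        hallNumberQ T (cls T x) (cls T y) c * hallNumberQ T c (cls T z) (cls T t)
      = ∑ᶠ c : IsoClass T,
          hallNumberQ T (cls T y) (cls T z) c * hallNumberQ T (cls T x) c (cls T t) := by
  exact ⟨fun w => by rw [hallNumberQ_cls, hallNumberQ_cls], hallNumber_mul_sums hfin x y z t⟩

end DerivedHall
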